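/- arXiv:2003.06193 — 2 statements merged into one kernel-verified Lean document; each statement's English description precedes it below -/
import Mathlib

section
/- Let p be a real polynomial map p: ℝ² → ℝ² with components (f,g) whose Jacobian determinant is everywhere positive or everywhere negative. Then (f,g) is injective if and only if all level sets f⁻¹(t), t ∈ ℝ, are connected. -/
open MvPolynomial

noncomputable def Jac (f g : MvPolynomial (Fin 2) ℝ) : MvPolynomial (Fin 2) ℝ :=
  pderiv 0 f * pderiv 1 g - pderiv 1 f * pderiv 0 g

/-- Real specialization at `q` of a polynomial whose coefficients are polynomials on the plane. -/
noncomputable abbrev specialize (q : Fin 2 → ℝ) (R : Polynomial (MvPolynomial (Fin 2) ℝ)) :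
    Polynomial ℝ := R.map (eval q)

lemma exists_common_denominator (P : MvPolynomial (Fin 2) ℝ)
    (D : Polynomial (MvPolynomial (Fin 2) ℝ)) (N : Fin 2 → Polynomial (MvPolynomial (Fin 2) ℝ)) :
    ∃ (n : ℕ) (T : Polynomial (MvPolynomial (Fin 2) ℝ)), ∀ (K : Type) [Field K]
      (θ : Polynomial (MvPolynomial (Fin 2) ℝ) →+* K), θ D ≠ 0 →
        eval₂ ((θ.comp Polynomial.C).comp C) (fun i => θ (N i) / θ D) P * θ D ^ n = θ T := by
  induction P using MvPolynomial.induction_on with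
  | C a => exact ⟨0, Polynomial.C (C a), fun K _ θ _ => by simp⟩
  | add P Q hP hQ =>
    obtain ⟨n, T, hT⟩ := hP
    obtain ⟨m, S, hS⟩ := hQ
    refine ⟨n + m, T * D ^ m + S * D ^ n, fun K _ θ hD => ?_⟩
    simp only [eval₂_add, map_add, map_mul, map_pow, ← hT K θ hD, ← hS K θ hD]
    ring
  | mul_X P i hP =>
    obtain ⟨n, T, hT⟩ := hP
    refine ⟨n + 1, T * N i, fun K _ θ hD => ?_⟩
    simp only [eval₂_mul, eval₂_X, map_mul, ← hT K θ hD]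
    field_simp
    ring

section Field

variable {A F E : Type} [CommRing A] [IsDomain A] [Field F] [Field E] [Algebra A F]
  [IsFractionRing A F] [Algebra A E] [Algebra F E] [IsScalarTower A F E]

lemma exists_map_eq_smul (p : Polynomial F) :
    ∃ b : A, b ≠ 0 ∧ ∃ P : Polynomial A, P.map (algebraMap A F) = b • p := by
  obtain ⟨b, hb, h⟩ := IsLocalization.integerNormalization_spec (nonZeroDivisors A) p
  exact ⟨b, nonZeroDivisors.ne_zero hb, _, h⟩

lemma exists_integral_minpoly [CharZero F] (l : E) (hl : IsIntegral F l) :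
    ∃ (R : Polynomial A) (d : A), d ≠ 0 ∧ R ≠ 0 ∧ Polynomial.aeval l R = 0 ∧
      (∃ a b : Polynomial A, a * R + b * R.derivative = Polynomial.C d) ∧
      ∀ W : Polynomial A, Polynomial.aeval l W = 0 →
        ∃ e : A, e ≠ 0 ∧ ∃ S : Polynomial A, Polynomial.C e * W = R * S := by
  have hinj := Polynomial.map_injective _ (IsFractionRing.injective A F)
  obtain ⟨r, hr, R, hR⟩ := exists_map_eq_smul (A := A) (minpoly F l)
  have hr' : algebraMap A F r ≠ 0 := by
    simpa using (IsFractionRing.injective A F).ne hr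
  have hmap : R.map (algebraMap A F) = Polynomial.C (algebraMap A F r) * minpoly F l := by
    rw [hR, ← IsScalarTower.algebraMap_smul F r, Polynomial.smul_eq_C_mul]
  have hdvd : ∀ p : Polynomial F, minpoly F l ∣ p → ∃ e : A, e ≠ 0 ∧ ∃ S : Polynomial A,
      S.map (algebraMap A F) * R.map (algebraMap A F) = Polynomial.C (algebraMap A F e) * p := by
    rintro p ⟨s, rfl⟩
    obtain ⟨b, hb, S, hS⟩ := exists_map_eq_smul (A := A) s
    refine ⟨r * b, mul_ne_zero hr hb, S, ?_⟩
    rw [hS, hmap, ← IsScalarTower.algebraMap_smul F b, Polynomial.smul_eq_C_mul]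
    simp only [map_mul]
    ring
  have hsep : (R.map (algebraMap A F)).Separable := by
    rw [hmap]
    exact (minpoly.irreducible hl).separable.unit_mul
      ((Polynomial.isUnit_C).2 (isUnit_iff_ne_zero.2 hr'))
  obtain ⟨a, b, hab⟩ := hsep
  obtain ⟨a₀, ha₀, P, hP⟩ := exists_map_eq_smul (A := A) a
  obtain ⟨b₀, hb₀, Q, hQ⟩ := exists_map_eq_smul (A := A) b
  refine ⟨R, a₀ * b₀, mul_ne_zero ha₀ hb₀, ?_, ?_, ⟨Polynomial.C b₀ * P, Polynomial.C a₀ * Q, ?_⟩,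
    fun W hW => ?_⟩
  · rintro rfl
    rw [Polynomial.map_zero] at hmap
    exact mul_ne_zero (Polynomial.C_ne_zero.2 hr') (minpoly.ne_zero hl) hmap.symm
  · rw [← Polynomial.aeval_map_algebraMap F, hmap]
    simp
  · apply hinj
    rw [← IsScalarTower.algebraMap_smul F, Polynomial.smul_eq_C_mul] at hP hQ
    simp only [Polynomial.map_add, Polynomial.map_mul, Polynomial.map_C, hP, hQ, map_mul]
    rw [← Polynomial.derivative_map]
    linear_combination (Polynomial.C (algebraMap A F a₀) * Polynomial.C (algebraMap A F b₀)) * hab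
  · obtain ⟨e, he, S, hS⟩ := hdvd (W.map (algebraMap A F))
      (minpoly.dvd F l (by rwa [Polynomial.aeval_map_algebraMap]))
    refine ⟨e, he, S, hinj ?_⟩
    simp only [Polynomial.map_mul, Polynomial.map_C, ← hS]
    ring

end Field

/-- The polynomial map of the plane with components `G 0`, `G 1`. -/
noncomputable def polyMap (G : Fin 2 → MvPolynomial (Fin 2) ℝ) (p : Fin 2 → ℝ) : Fin 2 → ℝ :=
  fun i => eval p (G i)

lemma eval_polyMap (G : Fin 2 → MvPolynomial (Fin 2) ℝ) (p : Fin 2 → ℝ)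
    (P : MvPolynomial (Fin 2) ℝ) : eval (polyMap G p) P = eval p (aeval G P) := by
  induction P using MvPolynomial.induction_on with
  | C a => simp
  | add P Q hP hQ => simp [hP, hQ]
  | mul_X P i hP => simp [hP, polyMap]

/-- `R` is an eliminant of the linear form (or polynomial) `l` along the map `polyMap G`,
generically faithful off the zero set of `d`. -/
structure IsEliminant (G : Fin 2 → MvPolynomial (Fin 2) ℝ) (l : MvPolynomial (Fin 2) ℝ)
    (R : Polynomial (MvPolynomial (Fin 2) ℝ)) (d : MvPolynomial (Fin 2) ℝ) : Prop where
  ne_zero : d ≠ 0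
  eval_eq_zero : ∀ p, (specialize (polyMap G p) R).eval (eval p l) = 0
  natDegree_eq : ∀ q, eval q d ≠ 0 → (specialize q R).natDegree = R.natDegree
  specialize_ne_zero : ∀ q, eval q d ≠ 0 → specialize q R ≠ 0
  derivative_ne_zero : ∀ q, eval q d ≠ 0 → ∀ t, (specialize q R).eval t = 0 →
    (specialize q R).derivative.eval t ≠ 0
  exists_preimage : ∀ q, eval q d ≠ 0 → ∀ t, (specialize q R).eval t = 0 →
    ∃ p, polyMap G p = q ∧ eval p l = t

open IntermediateField in
lemma exists_isEliminant_of_adjoin_eq_top {E : Type} [Field E] [Algebra ℝ E]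
    [Algebra (MvPolynomial (Fin 2) ℝ) E] [Algebra (FractionRing (MvPolynomial (Fin 2) ℝ)) E]
    [IsScalarTower (MvPolynomial (Fin 2) ℝ) (FractionRing (MvPolynomial (Fin 2) ℝ)) E]
    [IsScalarTower ℝ (MvPolynomial (Fin 2) ℝ) E]
    (G : Fin 2 → MvPolynomial (Fin 2) ℝ) (x : Fin 2 → E) (hx : AlgebraicIndependent ℝ x)
    (hG : ∀ i, algebraMap (MvPolynomial (Fin 2) ℝ) E (X i) = aeval x (G i))
    (l : MvPolynomial (Fin 2) ℝ)
    (hl : IsIntegral (FractionRing (MvPolynomial (Fin 2) ℝ)) (aeval x l))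
    (htop : (FractionRing (MvPolynomial (Fin 2) ℝ))⟮aeval x l⟯ = ⊤) :
    ∃ R d, IsEliminant G l R d := by
  obtain ⟨R, d, hd, hR0, hRl, ⟨a, b, hab⟩, hker⟩ :=
    exists_integral_minpoly (A := MvPolynomial (Fin 2) ℝ) _ hl
  have hcoord : ∀ i, ∃ D : MvPolynomial (Fin 2) ℝ, D ≠ 0 ∧
      ∃ N : Polynomial (MvPolynomial (Fin 2) ℝ),
      Polynomial.aeval (aeval x l) N = algebraMap _ E D * x i := by
    intro i
    have hmem : x i ∈ Algebra.adjoin (FractionRing (MvPolynomial (Fin 2) ℝ)) {aeval x l} := by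
      rw [← IntermediateField.adjoin_simple_toSubalgebra_of_isAlgebraic hl.isAlgebraic, htop]
      trivial
    rw [Algebra.adjoin_singleton_eq_range_aeval] at hmem
    obtain ⟨P, hP⟩ := hmem
    obtain ⟨D, hD, N, hN⟩ := exists_map_eq_smul (A := MvPolynomial (Fin 2) ℝ) P
    refine ⟨D, hD, N, ?_⟩
    rw [← Polynomial.aeval_map_algebraMap (FractionRing (MvPolynomial (Fin 2) ℝ)), hN,
      ← IsScalarTower.algebraMap_smul (FractionRing (MvPolynomial (Fin 2) ℝ)) D, map_smul,
      Algebra.smul_def, ← IsScalarTower.algebraMap_apply]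
    exact congrArg _ hP
  choose D hD N hN using hcoord
  set D' : MvPolynomial (Fin 2) ℝ := D 0 * D 1
  have hD' : D' ≠ 0 := mul_ne_zero (hD 0) (hD 1)
  set N' : Fin 2 → Polynomial (MvPolynomial (Fin 2) ℝ) :=
    ![Polynomial.C (D 1) * N 0, Polynomial.C (D 0) * N 1]
  have hinj : Function.Injective (algebraMap (MvPolynomial (Fin 2) ℝ) E) := by
    rw [IsScalarTower.algebraMap_eq _ (FractionRing (MvPolynomial (Fin 2) ℝ)) E]
    exact (algebraMap (FractionRing (MvPolynomial (Fin 2) ℝ)) E).injective.comp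
      (IsFractionRing.injective _ _)
  let θ : Polynomial (MvPolynomial (Fin 2) ℝ) →+* E :=
    (Polynomial.aeval (R := MvPolynomial (Fin 2) ℝ) (aeval x l : E)).toRingHom
  have hθC : ∀ c, θ (Polynomial.C c) = algebraMap _ E c := fun c => by simp [θ]
  have hθD : θ (Polynomial.C D') ≠ 0 := by
    rw [hθC]
    simpa using hinj.ne hD'
  have hθN : ∀ i, θ (N' i) / θ (Polynomial.C D') = x i := by
    intro i
    rw [div_eq_iff hθD, hθC]
    have h0 : θ (N 0) = _ := hN 0
    have h1 : θ (N 1) = _ := hN 1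
    fin_cases i
    · simp [N', D', hθC, h0]; ring
    · simp [N', D', hθC, h1]; ring
  have hpull : ∀ (P : MvPolynomial (Fin 2) ℝ) (W : Polynomial (MvPolynomial (Fin 2) ℝ)),
      θ W = aeval x P → ∃ e : MvPolynomial (Fin 2) ℝ, e ≠ 0 ∧ ∀ q t, eval q e ≠ 0 →
        eval q D' ≠ 0 → (specialize q R).eval t = 0 →
        eval (fun i => (specialize q (N' i)).eval t / eval q D') P = (specialize q W).eval t := by
    intro P W hW
    obtain ⟨n, T, hT⟩ := exists_common_denominator P (Polynomial.C D') N'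
    have hz : θ (T - W * Polynomial.C D' ^ n) = 0 := by
      rw [map_sub, map_mul, map_pow, ← hT E θ hθD, hW, ← sub_mul]
      simp only [hθN]
      rw [mul_eq_zero]
      left
      rw [aeval_def, sub_eq_zero]
      congr 1
      ext c
      simp only [RingHom.comp_apply, hθC]
      exact (IsScalarTower.algebraMap_apply ℝ (MvPolynomial (Fin 2) ℝ) E c).symm
    obtain ⟨e, he, S, hS⟩ := hker _ hz
    refine ⟨e, he, fun q t hqe hqD hqR => ?_⟩
    let ε : Polynomial (MvPolynomial (Fin 2) ℝ) →+* ℝ :=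
      (Polynomial.evalRingHom t).comp (Polynomial.mapRingHom (eval q))
    have hε : ∀ P, ε P = (specialize q P).eval t := fun P => rfl
    have hεC : ∀ c, ε (Polynomial.C c) = eval q c := fun c => by simp [hε, specialize]
    have h1 := hT ℝ ε (by rwa [hεC])
    have h2 := congrArg ε hS
    rw [map_mul ε, map_mul ε, hε R, hqR, zero_mul, hεC, map_sub ε, map_mul ε, map_pow ε, ← h1,
      hεC, ← sub_mul] at h2
    have h3 := (mul_eq_zero.1 ((mul_eq_zero.1 h2).resolve_left hqe)).resolve_right
      (pow_ne_zero _ hqD)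
    have h4 := sub_eq_zero.1 h3
    rw [← hε, ← h4]
    have : (ε.comp Polynomial.C).comp C = RingHom.id ℝ := by
      ext c
      simp
    rw [this]
    rfl
  choose e he hpre using fun i => hpull (G i) (Polynomial.C (X i)) (by rw [hθC, hG])
  obtain ⟨e', he', hpre'⟩ := hpull l Polynomial.X (by simp [θ])
  refine ⟨R, d * D' * e 0 * e 1 * e' * R.leadingCoeff, ?_, ?_, ?_, ?_, ?_, ?_⟩
  · exact mul_ne_zero (mul_ne_zero (mul_ne_zero (mul_ne_zero (mul_ne_zero hd hD') (he 0)) (he 1))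
      he') (Polynomial.leadingCoeff_ne_zero.2 hR0)
  · intro p
    have hz : Polynomial.eval₂ (aeval G).toRingHom l R = 0 := by
      apply hx
      rw [map_zero]
      change (aeval x).toRingHom _ = 0
      rw [Polynomial.hom_eval₂, ← hRl, Polynomial.aeval_def]
      congr 1
      apply MvPolynomial.ringHom_ext
      · intro c
        simp [IsScalarTower.algebraMap_apply ℝ (MvPolynomial (Fin 2) ℝ) E c,
          MvPolynomial.algebraMap_eq]
      · intro i
        simp [hG]
    have := congrArg (eval p) hz
    rw [Polynomial.hom_eval₂, map_zero] at this
    rw [specialize, Polynomial.eval_map, ← this]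
    congr 1
    apply RingHom.ext
    intro P
    exact eval_polyMap G p P
  all_goals
    intro q hq
    simp only [map_mul, mul_ne_zero_iff] at hq
    obtain ⟨⟨⟨⟨⟨hqd, hqD⟩, hq0⟩, hq1⟩, hq'⟩, hqR⟩ := hq
  · exact Polynomial.natDegree_map_of_leadingCoeff_ne_zero _ hqR
  · intro h
    apply hqR
    have := congrArg (Polynomial.coeff · R.natDegree) h
    simpa [specialize] using this
  · intro t ht h
    apply hqd
    have := congrArg (fun P => (specialize q P).eval t) hab
    simp only [specialize, Polynomial.map_add, Polynomial.map_mul, Polynomial.eval_add,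
      Polynomial.eval_mul, Polynomial.map_C, Polynomial.eval_C] at this
    rw [← this, ht, ← Polynomial.derivative_map, h]
    simp
  · intro t ht
    refine ⟨_, funext fun i => ?_, (hpre' q t hq' hqD ht).trans ?_⟩
    · refine (hpre i q t ?_ hqD ht).trans (by simp [specialize])
      fin_cases i
      exacts [hq0, hq1]
    · simp [specialize]

open IntermediateField in
lemma infinite_setOf_adjoin_add_smul_eq_top {F E : Type} [Field F] [Field E] [Algebra F E]
    [CharZero F] [Algebra ℝ E] (x y : E) (hx : IsIntegral F x) (hy : IsIntegral F y)
    (hc : ∀ c : ℝ, algebraMap ℝ E c ∈ (algebraMap F E).range)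
    (htop : IntermediateField.adjoin F {x, y} = ⊤) :
    {c : ℝ | F⟮x + algebraMap ℝ E c * y⟯ = ⊤}.Infinite := by
  have : FiniteDimensional F E := by
    have h := IntermediateField.finiteDimensional_adjoin (K := F) (S := ({x, y} : Set E)) (by
      rintro z (rfl | rfl) <;> assumption)
    rw [htop] at h
    exact IntermediateField.topEquiv.toLinearEquiv.finiteDimensional
  have hfin : Finite (IntermediateField F E) :=
    (Field.exists_primitive_element_iff_finite_intermediateField F E).1
      ⟨inferInstance, Field.exists_primitive_element F E⟩
  have hbad : {c : ℝ | F⟮x + algebraMap ℝ E c * y⟯ ≠ ⊤}.Finite := by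
    refine Set.Finite.of_finite_image (f := fun c : ℝ => F⟮x + algebraMap ℝ E c * y⟯)
      (Set.toFinite _) ?_
    intro c hcb c' _ h
    by_contra hne
    apply hcb
    have hmem : ∀ r : ℝ, algebraMap ℝ E r ∈ F⟮x + algebraMap ℝ E c * y⟯ := by
      intro r
      obtain ⟨s, hs⟩ := hc r
      rw [← hs]
      exact IntermediateField.algebraMap_mem _ s
    have h1 := IntermediateField.mem_adjoin_simple_self F (x + algebraMap ℝ E c * y)
    have h2 := IntermediateField.mem_adjoin_simple_self F (x + algebraMap ℝ E c' * y)
    simp only at h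
    rw [← h] at h2
    have hy' : y ∈ F⟮x + algebraMap ℝ E c * y⟯ := by
      have h3 := mul_mem (inv_mem (hmem (c - c'))) (sub_mem h1 h2)
      convert h3 using 1
      have : algebraMap ℝ E (c - c') ≠ 0 := by
        exact (map_ne_zero _).2 (sub_ne_zero.2 hne)
      rw [eq_inv_mul_iff_mul_eq₀ this, map_sub]
      ring
    have hx' : x ∈ F⟮x + algebraMap ℝ E c * y⟯ := by
      simpa using sub_mem h1 (mul_mem (hmem c) hy')
    rw [eq_top_iff, ← htop, IntermediateField.adjoin_le_iff]
    rintro z (rfl | rfl) <;> assumption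
  have := hbad.infinite_compl
  simpa [Set.compl_def] using this

lemma infinite_setOf_exists_isEliminant_of_field {E : Type} [Field E] [Algebra ℝ E]
    [Algebra (MvPolynomial (Fin 2) ℝ) E] [FaithfulSMul (MvPolynomial (Fin 2) ℝ) E]
    [IsScalarTower ℝ (MvPolynomial (Fin 2) ℝ) E]
    (G : Fin 2 → MvPolynomial (Fin 2) ℝ) (x : Fin 2 → E) (hx : AlgebraicIndependent ℝ x)
    (hG : ∀ i, algebraMap (MvPolynomial (Fin 2) ℝ) E (X i) = aeval x (G i))
    (halg : ∀ i, IsAlgebraic (MvPolynomial (Fin 2) ℝ) (x i))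
    (hgen : ∀ z : E, ∃ P Q : MvPolynomial (Fin 2) ℝ, z = aeval x P / aeval x Q) :
    {c : ℝ | ∃ R d, IsEliminant G (X 0 + C c * X 1) R d}.Infinite := by
  let := FractionRing.liftAlgebra (MvPolynomial (Fin 2) ℝ) E
  have hint : ∀ i, IsIntegral (FractionRing (MvPolynomial (Fin 2) ℝ)) (x i) := fun i =>
    ((halg i).extendScalars (IsFractionRing.injective (MvPolynomial (Fin 2) ℝ)
      (FractionRing (MvPolynomial (Fin 2) ℝ)))).isIntegral
  have hc : ∀ c : ℝ, algebraMap ℝ E c ∈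
      (algebraMap (FractionRing (MvPolynomial (Fin 2) ℝ)) E).range := by
    intro c
    refine ⟨algebraMap (MvPolynomial (Fin 2) ℝ) _ (C c), ?_⟩
    rw [← IsScalarTower.algebraMap_apply]
    exact (IsScalarTower.algebraMap_apply ℝ (MvPolynomial (Fin 2) ℝ) E c).symm
  have htop : IntermediateField.adjoin (FractionRing (MvPolynomial (Fin 2) ℝ)) {x 0, x 1} = ⊤ := by
    rw [eq_top_iff]
    have hP : ∀ P : MvPolynomial (Fin 2) ℝ, aeval x P ∈
        IntermediateField.adjoin (FractionRing (MvPolynomial (Fin 2) ℝ)) {x 0, x 1} := by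
      intro P
      induction P using MvPolynomial.induction_on with
      | C a =>
        obtain ⟨s, hs⟩ := hc a
        rw [aeval_C, ← hs]
        exact IntermediateField.algebraMap_mem _ s
      | add P Q hP hQ => rw [map_add]; exact add_mem hP hQ
      | mul_X P i hP =>
        rw [map_mul, aeval_X]
        refine mul_mem hP (IntermediateField.subset_adjoin _ _ ?_)
        fin_cases i <;> simp
    intro z _
    obtain ⟨P, Q, rfl⟩ := hgen z
    exact div_mem (hP P) (hP Q)
  refine (infinite_setOf_adjoin_add_smul_eq_top (x 0) (x 1) (hint 0) (hint 1) hc htop).mono ?_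
  intro c hctop
  have hl : aeval x (X 0 + C c * X 1 : MvPolynomial (Fin 2) ℝ) =
      x 0 + algebraMap ℝ E c * x 1 := by simp
  apply exists_isEliminant_of_adjoin_eq_top G x hx hG
  · rw [hl]
    obtain ⟨s, hs⟩ := hc c
    rw [← hs]
    exact (hint 0).add (isIntegral_algebraMap.mul (hint 1))
  · rw [hl]
    exact hctop

lemma infinite_setOf_exists_isEliminant_of_algHom {E : Type} [Field E] [Algebra ℝ E]
    (G : Fin 2 → MvPolynomial (Fin 2) ℝ) (hG : AlgebraicIndependent ℝ G)
    (g : MvPolynomial (Fin 2) ℝ →ₐ[ℝ] E) (hg : Function.Injective g)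
    (hgen : ∀ z : E, ∃ P Q : MvPolynomial (Fin 2) ℝ, z = g P / g Q) :
    {c : ℝ | ∃ R d, IsEliminant G (X 0 + C c * X 1) R d}.Infinite := by
  have hbasis : IsTranscendenceBasis ℝ G :=
    hG.isTranscendenceBasis_of_trdeg_le_of_finite (by simp [MvPolynomial.trdeg_of_isDomain])
  have hx : ∀ P, aeval (fun i => g (X i)) P = g P := by
    intro P
    exact (DFunLike.congr_fun (MvPolynomial.aeval_unique g) P).symm
  have hφ : Function.Injective (g.comp (aeval G)) := hg.comp hG
  let : Algebra (MvPolynomial (Fin 2) ℝ) E := (g.comp (aeval G)).toRingHom.toAlgebra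
  have hmap : ∀ P, algebraMap (MvPolynomial (Fin 2) ℝ) E P = g (aeval G P) := fun P => rfl
  have : FaithfulSMul (MvPolynomial (Fin 2) ℝ) E :=
    (faithfulSMul_iff_algebraMap_injective _ _).2 hφ
  have : IsScalarTower ℝ (MvPolynomial (Fin 2) ℝ) E :=
    IsScalarTower.of_algebraMap_eq fun c => ((g.comp (aeval G)).commutes c).symm
  refine infinite_setOf_exists_isEliminant_of_field G (fun i => g (X i)) ?_ ?_ ?_ ?_
  · intro P Q h
    rw [hx, hx] at h
    exact hg h
  · intro i
    rw [hx, hmap, aeval_X]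
  · intro i
    have h := hbasis.isAlgebraic.isAlgebraic (X i)
    refine h.ringHom_of_comp_eq hG.aevalEquiv.symm.toRingEquiv.toRingHom g.toRingHom
      hG.aevalEquiv.symm.injective ?_
    apply RingHom.ext
    intro s
    obtain ⟨P, rfl⟩ := hG.aevalEquiv.surjective s
    simp [hmap]
  · intro z
    obtain ⟨P, Q, h⟩ := hgen z
    exact ⟨P, Q, by rw [hx, hx, h]⟩

lemma infinite_setOf_exists_isEliminant (G : Fin 2 → MvPolynomial (Fin 2) ℝ)
    (hG : AlgebraicIndependent ℝ G) :
    {c : ℝ | ∃ R d, IsEliminant G (X 0 + C c * X 1) R d}.Infinite := by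
  refine infinite_setOf_exists_isEliminant_of_algHom G hG
    (IsScalarTower.toAlgHom ℝ (MvPolynomial (Fin 2) ℝ) (FractionRing (MvPolynomial (Fin 2) ℝ)))
    (IsFractionRing.injective (MvPolynomial (Fin 2) ℝ) _) fun z => ?_
  obtain ⟨P, Q, -, h⟩ := IsFractionRing.div_surjective (A := MvPolynomial (Fin 2) ℝ) z
  exact ⟨P, Q, h.symm⟩

section RealPolynomial

lemma mul_nonneg_of_continuous_of_ne_zero {f : ℝ → ℝ} (hf : Continuous f) (h : ∀ t, f t ≠ 0)
    (s t : ℝ) : 0 ≤ f s * f t := by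
  by_contra! hlt
  have hmem : ∃ u, f u = 0 := by
    rcases mul_neg_iff.1 hlt with ⟨h1, h2⟩ | ⟨h1, h2⟩
    · exact mem_range_of_exists_le_of_exists_ge hf ⟨t, h2.le⟩ ⟨s, h1.le⟩
    · exact mem_range_of_exists_le_of_exists_ge hf ⟨s, h1.le⟩ ⟨t, h2.le⟩
  obtain ⟨u, hu⟩ := hmem
  exact h u hu

lemma even_natDegree_of_mul_nonneg {P : Polynomial ℝ} (hP : P ≠ 0)
    (h : ∀ s t, 0 ≤ P.eval s * P.eval t) : Even P.natDegree := by
  by_contra hodd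
  rw [Nat.not_even_iff_odd] at hodd
  set Q := -(P * P.comp (-Polynomial.X)) with hQ
  have hnd : (-Polynomial.X : Polynomial ℝ).natDegree = 1 := by simp
  have hlc : Q.leadingCoeff = P.leadingCoeff ^ 2 := by
    rw [hQ, Polynomial.leadingCoeff_neg, Polynomial.leadingCoeff_mul,
      Polynomial.leadingCoeff_comp (by rw [hnd]; exact one_ne_zero), Polynomial.leadingCoeff_neg,
      Polynomial.leadingCoeff_X, hodd.neg_one_pow]
    ring
  have hdeg : 0 < Q.degree := by
    rw [← Polynomial.natDegree_pos_iff_degree_pos, hQ, Polynomial.natDegree_neg,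
      Polynomial.natDegree_mul hP (by
        rw [← Polynomial.leadingCoeff_ne_zero,
          Polynomial.leadingCoeff_comp (by rw [hnd]; exact one_ne_zero)]
        simpa using hP)]
    have := hodd.pos
    omega
  have htend := Polynomial.tendsto_atTop_of_leadingCoeff_nonneg Q hdeg (by rw [hlc]; positivity)
  obtain ⟨t, ht⟩ := (htend.eventually (Filter.eventually_gt_atTop 0)).exists
  have := h t (-t)
  simp [hQ] at ht
  linarith

lemma odd_natDegree_of_mul_nonneg {P : Polynomial ℝ} (hP : P ≠ 0) (a : ℝ)
    (h : ∀ s t, 0 ≤ (P.eval s * (s - a)) * (P.eval t * (t - a))) : Odd P.natDegree := by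
  have := even_natDegree_of_mul_nonneg (mul_ne_zero hP (Polynomial.X_sub_C_ne_zero a))
    (fun s t => by simpa using h s t)
  rw [Polynomial.natDegree_mul hP (Polynomial.X_sub_C_ne_zero a), Polynomial.natDegree_X_sub_C]
    at this
  simpa [Nat.even_add_one] using this

lemma mul_nonneg_of_unique_simple_root {P : Polynomial ℝ} {a : ℝ} (ha : P.eval a = 0)
    (ha' : P.derivative.eval a ≠ 0) (huniq : ∀ b, P.eval b = 0 → b = a) (s t : ℝ) :
    0 ≤ (P.eval s * (s - a)) * (P.eval t * (t - a)) := by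
  obtain ⟨S, hS⟩ := Polynomial.dvd_iff_isRoot.2 ha
  have hroot : ∀ b, S.eval b ≠ 0 := by
    intro b hb
    have hba : b = a := huniq b (by simp [hS, hb])
    subst hba
    apply ha'
    simp [hS, hb]
  have := mul_nonneg_of_continuous_of_ne_zero S.continuous hroot s t
  have h2 : (P.eval s * (s - a)) * (P.eval t * (t - a)) =
      (S.eval s * S.eval t) * ((s - a) * (t - a)) ^ 2 := by
    simp [hS]
    ring
  rw [h2]
  positivity

end RealPolynomial

lemma dense_setOf_eval_ne_zero {P : MvPolynomial (Fin 2) ℝ} (hP : P ≠ 0) :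
    Dense {p : Fin 2 → ℝ | eval p P ≠ 0} := by
  rw [dense_iff_inter_open]
  rintro U hU ⟨x, hx⟩
  obtain ⟨ε, hε, hball⟩ := Metric.isOpen_iff.1 hU x hx
  by_contra hne
  rw [Set.not_nonempty_iff_eq_empty] at hne
  apply hP
  refine MvPolynomial.funext_set (fun i => Metric.ball (x i) ε) (fun i => ?_) fun y hy => ?_
  · rw [Real.ball_eq_Ioo]
    exact Set.Ioo_infinite (by linarith)
  · rw [map_zero]
    by_contra h
    have hy' : y ∈ Metric.ball x ε := by
      rw [Metric.mem_ball, dist_pi_lt_iff hε]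
      exact fun i => hy i trivial
    have : y ∈ U ∩ {p | eval p P ≠ 0} := ⟨hball hy', h⟩
    rw [hne] at this
    exact this

lemma eval_specialize (R : Polynomial (MvPolynomial (Fin 2) ℝ)) (q : Fin 2 → ℝ) (t : ℝ) :
    (specialize q R).eval t = eval q (R.eval (C t)) := by
  rw [specialize, Polynomial.eval_map]
  simpa using Polynomial.eval₂_at_apply (p := R) (eval q) (C t)

lemma continuous_polyMap (G : Fin 2 → MvPolynomial (Fin 2) ℝ) : Continuous (polyMap G) :=
  continuous_pi fun i => MvPolynomial.continuous_eval (G i)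

lemma continuous_eval_specialize (R : Polynomial (MvPolynomial (Fin 2) ℝ)) (t : ℝ) :
    Continuous fun q => (specialize q R).eval t := by
  simp only [eval_specialize]
  exact MvPolynomial.continuous_eval _

/-- Along the map `polyMap G`, the polynomial `R` changes sign only at the value of `l`. -/
def ChangesSignAt (G : Fin 2 → MvPolynomial (Fin 2) ℝ) (l : MvPolynomial (Fin 2) ℝ)
    (R : Polynomial (MvPolynomial (Fin 2) ℝ)) : Prop :=
  ∀ p s t, 0 ≤ ((specialize (polyMap G p) R).eval s * (s - eval p l)) *
    ((specialize (polyMap G p) R).eval t * (t - eval p l))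

section ChangesSign

variable {G : Fin 2 → MvPolynomial (Fin 2) ℝ} {l : MvPolynomial (Fin 2) ℝ}
  {R : Polynomial (MvPolynomial (Fin 2) ℝ)} {d : MvPolynomial (Fin 2) ℝ}

lemma dense_setOf_eval_polyMap_ne_zero (hG : AlgebraicIndependent ℝ G) (hd : d ≠ 0) :
    Dense {p | eval (polyMap G p) d ≠ 0} := by
  simp only [eval_polyMap]
  exact dense_setOf_eval_ne_zero ((map_ne_zero_iff _ hG).2 hd)

lemma changesSignAt_of_dense {S : Set (Fin 2 → ℝ)} (hS : Dense S)
    (h : ∀ p ∈ S, ∀ s t, 0 ≤ ((specialize (polyMap G p) R).eval s * (s - eval p l)) *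
      ((specialize (polyMap G p) R).eval t * (t - eval p l))) : ChangesSignAt G l R := by
  intro p s t
  have hcl : IsClosed {p | 0 ≤ ((specialize (polyMap G p) R).eval s * (s - eval p l)) *
      ((specialize (polyMap G p) R).eval t * (t - eval p l))} := by
    have h1 := (continuous_eval_specialize R s).comp (continuous_polyMap G)
    have h2 := (continuous_eval_specialize R t).comp (continuous_polyMap G)
    have h3 := MvPolynomial.continuous_eval l
    exact isClosed_le continuous_const
      ((h1.mul (continuous_const.sub h3)).mul (h2.mul (continuous_const.sub h3)))
  have := hcl.closure_subset_iff.2 (fun p hp => h p hp s t)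
  rw [hS.closure_eq] at this
  exact this trivial

lemma IsEliminant.changesSignAt (hR : IsEliminant G l R d) (hG : AlgebraicIndependent ℝ G)
    (hinj : Function.Injective (polyMap G)) : ChangesSignAt G l R := by
  refine changesSignAt_of_dense (dense_setOf_eval_polyMap_ne_zero hG hR.ne_zero)
    fun p hp s t => ?_
  refine mul_nonneg_of_unique_simple_root (hR.eval_eq_zero p)
    (hR.derivative_ne_zero _ hp _ (hR.eval_eq_zero p)) (fun b hb => ?_) s t
  obtain ⟨p', hp', rfl⟩ := hR.exists_preimage _ hp b hb
  rw [hinj hp']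

lemma ChangesSignAt.of_mul (hG : AlgebraicIndependent ℝ G) (hd : d ≠ 0)
    (h : ChangesSignAt G l (Polynomial.C d * R)) : ChangesSignAt G l R := by
  refine changesSignAt_of_dense (dense_setOf_eval_polyMap_ne_zero hG hd) fun p hp s t => ?_
  have h1 := h p s t
  have hp' : 0 < eval (polyMap G p) d ^ 2 := by
    have hp : eval (polyMap G p) d ≠ 0 := hp
    positivity
  simp only [specialize, Polynomial.map_mul, Polynomial.map_C, Polynomial.eval_mul,
    Polynomial.eval_C] at h1 ⊢
  refine nonneg_of_mul_nonneg_right (h1.trans_eq ?_) hp'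
  ring

lemma ChangesSignAt.odd_natDegree (h : ChangesSignAt G l R) (p : Fin 2 → ℝ)
    (h0 : specialize (polyMap G p) R ≠ 0) : Odd (specialize (polyMap G p) R).natDegree :=
  odd_natDegree_of_mul_nonneg h0 _ (h p)

lemma ChangesSignAt.even_natDegree (h : ChangesSignAt G l R) (q : Fin 2 → ℝ)
    (h0 : specialize q R ≠ 0)
    (hq : ∀ V ∈ nhds q, ∀ M : ℝ, ∃ p, polyMap G p ∈ V ∧ M < |eval p l|) :
    Even (specialize q R).natDegree := by
  refine even_natDegree_of_mul_nonneg h0 fun s t => ?_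
  by_contra! hlt
  have hcont : Continuous fun q => (specialize q R).eval s * (specialize q R).eval t :=
    (continuous_eval_specialize R s).mul (continuous_eval_specialize R t)
  obtain ⟨p, hp, hM⟩ := hq _ (hcont.continuousAt.eventually_lt continuousAt_const hlt)
    (max |s| |t|)
  have h1 := h p s t
  have h2 : 0 < (s - eval p l) * (t - eval p l) := by
    rcases lt_abs.1 hM with h' | h'
    · have h3 := abs_lt.1 ((le_max_left |s| |t|).trans_lt h')
      have h4 := abs_lt.1 ((le_max_right |s| |t|).trans_lt h')
      nlinarith
    · have h3 := abs_lt.1 ((le_max_left |s| |t|).trans_lt h')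
      have h4 := abs_lt.1 ((le_max_right |s| |t|).trans_lt h')
      nlinarith
  have h3 := mul_neg_of_neg_of_pos hp h2
  linarith

lemma IsEliminant.mem_range (hR : IsEliminant G l R d) (hG : AlgebraicIndependent ℝ G)
    (hinj : Function.Injective (polyMap G)) {q : Fin 2 → ℝ} (hq : eval q d ≠ 0) :
    q ∈ Set.range (polyMap G) := by
  by_contra hnot
  have heven : Even R.natDegree := by
    rw [← hR.natDegree_eq q hq]
    refine even_natDegree_of_mul_nonneg (hR.specialize_ne_zero q hq)
      (mul_nonneg_of_continuous_of_ne_zero (Polynomial.continuous _) fun t ht => ?_)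
    obtain ⟨p, hp, -⟩ := hR.exists_preimage q hq t ht
    exact hnot ⟨p, hp⟩
  obtain ⟨p, hp⟩ := (dense_setOf_eval_polyMap_ne_zero hG hR.ne_zero).nonempty
  have hodd := (hR.changesSignAt hG hinj).odd_natDegree p (hR.specialize_ne_zero _ hp)
  rw [hR.natDegree_eq _ hp] at hodd
  exact Nat.not_even_iff_odd.2 hodd heven

end ChangesSign

lemma ker_eval_injective :
    Function.Injective fun q : Fin 2 → ℝ => RingHom.ker (eval (R := ℝ) q) := by
  intro q q' h
  funext i
  have h1 : (X i - C (q i) : MvPolynomial (Fin 2) ℝ) ∈ RingHom.ker (eval (R := ℝ) q) := by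
    simp [RingHom.mem_ker]
  have h2 : (X i - C (q i) : MvPolynomial (Fin 2) ℝ) ∈ RingHom.ker (eval (R := ℝ) q') := by
    simpa only [← h] using h1
  simpa [RingHom.mem_ker, sub_eq_zero, eq_comm] using h2

lemma finite_setOf_eval_eq_zero {h c : MvPolynomial (Fin 2) ℝ} (hh : Irreducible h)
    (hc : ¬ h ∣ c) : {q : Fin 2 → ℝ | eval q h = 0 ∧ eval q c = 0}.Finite := by
  set I : Ideal (MvPolynomial (Fin 2) ℝ) := Ideal.span {h, c} with hI
  refine Set.Finite.of_finite_image
    ((I.finite_minimalPrimes_of_isNoetherianRing (MvPolynomial (Fin 2) ℝ)).subset ?_)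
    (ker_eval_injective.injOn)
  rintro _ ⟨q, ⟨hq, hq'⟩, rfl⟩
  have hle : I ≤ RingHom.ker (eval (R := ℝ) q) := by
    rw [hI, Ideal.span_le]
    rintro x (rfl | rfl)
    · exact hq
    · exact hq'
  have hprime : (RingHom.ker (eval (R := ℝ) q)).IsPrime := RingHom.ker_isPrime _
  obtain ⟨P, hP, hPle⟩ := Ideal.exists_minimalPrimes_le hle
  rcases hPle.eq_or_lt with heq | hlt
  · simpa only [heq] using hP
  exfalso
  have hPprime : P.IsPrime := hP.1.1
  have hspan : (Ideal.span {h}).IsPrime :=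
    (Ideal.span_singleton_prime hh.ne_zero).2 hh.prime
  have hlt1 : (⊥ : Ideal (MvPolynomial (Fin 2) ℝ)) < Ideal.span {h} := by
    rw [bot_lt_iff_ne_bot, Ne, Ideal.span_singleton_eq_bot]
    exact hh.ne_zero
  have hlt2 : Ideal.span {h} < P := by
    refine lt_of_le_of_ne ?_ fun heq => hc ?_
    · rw [Ideal.span_singleton_le_iff_mem]
      exact hP.1.2 (Ideal.subset_span (Set.mem_insert _ _))
    · rw [← Ideal.mem_span_singleton, heq]
      exact hP.1.2 (Ideal.subset_span (Set.mem_insert_of_mem _ rfl))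
  let s : LTSeries (PrimeSpectrum (MvPolynomial (Fin 2) ℝ)) :=
    { length := 3
      toFun := ![⟨⊥, Ideal.isPrime_bot⟩, ⟨_, hspan⟩, ⟨P, hPprime⟩, ⟨_, hprime⟩]
      step := fun i => by
        fin_cases i
        · exact hlt1
        · exact hlt2
        · exact hlt }
  have hs := Order.LTSeries.length_le_krullDim s
  have hdim : ringKrullDim (MvPolynomial (Fin 2) ℝ) = 2 := by
    rw [MvPolynomial.ringKrullDim_of_isNoetherianRing, ringKrullDim_eq_zero_of_field]
    simp
  rw [← ringKrullDim, hdim] at hs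
  have h3 : s.length = 3 := rfl
  rw [h3] at hs
  have : (3 : ℕ) ≤ 2 := by exact_mod_cast hs
  omega

/-- Removing the factor `h` from `R` and reducing modulo `h` pins the degree of the specialization
at almost all points of the curve `h = 0`. -/
lemma exists_reduction {h : MvPolynomial (Fin 2) ℝ} (hh : Irreducible h)
    {R : Polynomial (MvPolynomial (Fin 2) ℝ)} (hR : R ≠ 0) :
    ∃ (e : MvPolynomial (Fin 2) ℝ) (R' : Polynomial (MvPolynomial (Fin 2) ℝ)) (n : ℕ)
      (c : MvPolynomial (Fin 2) ℝ), e ≠ 0 ∧ R = Polynomial.C e * R' ∧ ¬ h ∣ c ∧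
      ∀ q, eval q h = 0 → eval q c ≠ 0 → specialize q R' ≠ 0 ∧ (specialize q R').natDegree = n := by
  classical
  have hu : ¬ IsUnit (Polynomial.C h) := fun hu => hh.not_isUnit (Polynomial.isUnit_C.1 hu)
  obtain ⟨k, R', hnd, rfl⟩ :=
    WfDvdMonoid.max_power_factor hR (Polynomial.prime_C_iff.2 hh.prime).irreducible
  rw [Polynomial.C_dvd_iff_dvd_coeff] at hnd
  push Not at hnd
  have hex : ∃ n, ¬ h ∣ R'.coeff n ∧ ∀ m, n < m → h ∣ R'.coeff m := by
    set S := R'.support.filter fun i => ¬ h ∣ R'.coeff i with hS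
    have hSne : S.Nonempty := by
      obtain ⟨i, hi⟩ := hnd
      refine ⟨i, Finset.mem_filter.2 ⟨Polynomial.mem_support_iff.2 fun h0 => hi ?_, hi⟩⟩
      rw [h0]
      exact dvd_zero h
    refine ⟨S.max' hSne, (Finset.mem_filter.1 (S.max'_mem hSne)).2, fun m hm => ?_⟩
    by_contra hdiv
    have : m ∈ S := by
      refine Finset.mem_filter.2 ⟨Polynomial.mem_support_iff.2 fun h0 => hdiv ?_, hdiv⟩
      rw [h0]
      exact dvd_zero h
    exact (S.le_max' m this).not_gt hm
  obtain ⟨n, hn, hmax⟩ := hex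
  refine ⟨h ^ k, R', n, R'.coeff n, pow_ne_zero _ hh.ne_zero, by simp, hn, fun q hq hc => ?_⟩
  have hcoeff : (specialize q R').coeff n ≠ 0 := by simpa [Polynomial.coeff_map] using hc
  refine ⟨fun h0 => hcoeff (by simp [h0]),
    le_antisymm ?_ (Polynomial.le_natDegree_of_ne_zero hcoeff)⟩
  refine Polynomial.natDegree_le_iff_coeff_eq_zero.2 fun m hm => ?_
  obtain ⟨w, hw⟩ := hmax m hm
  rw [Polynomial.coeff_map, hw, map_mul, hq, zero_mul]

lemma hasStrictFDerivAt_eval (P : MvPolynomial (Fin 2) ℝ) (p : Fin 2 → ℝ) :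
    HasStrictFDerivAt (fun q : Fin 2 → ℝ => eval q P)
      (∑ j, eval p (pderiv j P) • ContinuousLinearMap.proj (R := ℝ) (φ := fun _ : Fin 2 => ℝ) j)
      p := by
  induction P using MvPolynomial.induction_on with
  | C a => simpa using hasStrictFDerivAt_const a p
  | add P Q hP hQ =>
    simp only [map_add, add_smul, Finset.sum_add_distrib]
    exact hP.add hQ
  | mul_X P i hP =>
    have h := hP.mul (hasStrictFDerivAt_apply (𝕜 := ℝ) i p)
    simp only [map_mul, eval_X]
    refine h.congr_fderiv ?_
    ext v
    fin_cases i <;> simp [Derivation.leibniz, pderiv_X] <;> ring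

section LocalStructure

variable {G : Fin 2 → MvPolynomial (Fin 2) ℝ}

lemma exists_hasStrictFDerivAt_polyMap {p : Fin 2 → ℝ} (hJ : eval p (Jac (G 0) (G 1)) ≠ 0) :
    ∃ e : (Fin 2 → ℝ) ≃L[ℝ] (Fin 2 → ℝ),
      HasStrictFDerivAt (polyMap G) (e : (Fin 2 → ℝ) →L[ℝ] (Fin 2 → ℝ)) p := by
  set A : (Fin 2 → ℝ) →L[ℝ] (Fin 2 → ℝ) := ContinuousLinearMap.pi fun i =>
    ∑ j, eval p (pderiv j (G i)) • ContinuousLinearMap.proj (R := ℝ) (φ := fun _ : Fin 2 => ℝ) j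
    with hA
  have hdet : A.det ≠ 0 := by
    have : A.det = eval p (Jac (G 0) (G 1)) := by
      rw [ContinuousLinearMap.det, ← LinearMap.det_toMatrix', Matrix.det_fin_two]
      simp [hA, LinearMap.toMatrix'_apply, Jac]
    rwa [this]
  refine ⟨A.toContinuousLinearEquivOfDetNeZero hdet, ?_⟩
  have : HasStrictFDerivAt (polyMap G) A p :=
    hasStrictFDerivAt_pi.2 fun i => hasStrictFDerivAt_eval (G i) p
  exact this

lemma isOpenMap_polyMap (hJ : ∀ p, eval p (Jac (G 0) (G 1)) ≠ 0) :
    IsOpenMap (polyMap G) := by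
  choose e he using fun p => exists_hasStrictFDerivAt_polyMap (hJ p)
  exact isOpenMap_of_hasStrictFDerivAt_equiv he

lemma isLocallyInjective_polyMap (hJ : ∀ p, eval p (Jac (G 0) (G 1)) ≠ 0) :
    IsLocallyInjective (polyMap G) := by
  intro p
  obtain ⟨e, he⟩ := exists_hasStrictFDerivAt_polyMap (hJ p)
  exact ⟨_, (he.toOpenPartialHomeomorph _).open_source, he.mem_toOpenPartialHomeomorph_source,
    (he.toOpenPartialHomeomorph _).injOn⟩

lemma algebraicIndependent_of_jac_ne_zero (hJ : ∀ p, eval p (Jac (G 0) (G 1)) ≠ 0) :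
    AlgebraicIndependent ℝ G := by
  rw [algebraicIndependent_iff]
  intro P hP
  by_contra hne
  obtain ⟨_, ⟨p, rfl⟩, hp⟩ := (dense_setOf_eval_ne_zero hne).inter_open_nonempty _
    (isOpenMap_polyMap hJ).isOpen_range (Set.range_nonempty _)
  refine hp ?_
  rw [eval_polyMap, hP, map_zero]

end LocalStructure

/-- An open set containing a punctured neighbourhood of a point not in it is not the
homeomorphic image of the plane. -/
lemma mem_range_of_eventually_mem_range {F : (Fin 2 → ℝ) → Fin 2 → ℝ} (hF : Continuous F)
    (ho : IsOpenMap F) (hinj : Function.Injective F) {a : Fin 2 → ℝ}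
    (ha : ∀ᶠ q in nhdsWithin a {a}ᶜ, q ∈ Set.range F) : a ∈ Set.range F := by
  by_contra hnot
  obtain ⟨ε, hε, hball⟩ := Metric.mem_nhdsWithin_iff.1 ha
  have hemb : Topology.IsOpenEmbedding F := .of_continuous_injective_isOpenMap hF hinj ho
  let circ : ℝ → Fin 2 → ℝ := fun s => ![a 0 + ε / 2 * Real.cos s, a 1 + ε / 2 * Real.sin s]
  have hcirc : Continuous circ := by
    refine continuous_pi fun i => ?_
    fin_cases i <;> simp [circ] <;> fun_prop
  have hcirc_mem : ∀ s, circ s ∈ Set.range F := by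
    intro s
    refine hball ⟨?_, fun h => ?_⟩
    · rw [Metric.mem_ball, dist_pi_lt_iff hε]
      have h1 := Real.abs_cos_le_one s
      have h2 := Real.abs_sin_le_one s
      intro i
      fin_cases i <;> simp [circ, abs_of_pos hε] <;> nlinarith
    · have h0 : a 0 + ε / 2 * Real.cos s = a 0 := congrFun h 0
      have h1 : a 1 + ε / 2 * Real.sin s = a 1 := congrFun h 1
      have hc : Real.cos s = 0 := by
        have := hε.ne'
        simpa [this] using h0
      have hs : Real.sin s = 0 := by
        have := hε.ne'
        simpa [this] using h1
      have := Real.sin_sq_add_cos_sq s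
      rw [hc, hs] at this
      norm_num at this
  choose γ hγ using hcirc_mem
  have hγc : Continuous γ := by
    rw [hemb.isEmbedding.continuous_iff]
    exact hcirc.congr fun s => (hγ s).symm
  let φ : C(Fin 2 → ℝ, {z : ℂ // z ≠ 0}) :=
    { toFun := fun p => ⟨(F p 0 - a 0 : ℝ) + (F p 1 - a 1 : ℝ) * Complex.I, fun h => hnot ⟨p, by
        have h0 := congrArg Complex.re h
        have h1 := congrArg Complex.im h
        simp at h0 h1
        funext i
        fin_cases i
        · simpa using sub_eq_zero.1 h0
        · simpa using sub_eq_zero.1 h1⟩⟩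
      continuous_toFun := by
        have h0 : Continuous fun p => F p 0 := (continuous_apply 0).comp hF
        have h1 : Continuous fun p => F p 1 := (continuous_apply 1).comp hF
        fun_prop }
  obtain ⟨Φ, ⟨-, hΦ⟩, -⟩ := Complex.isCoveringMap_exp.existsUnique_continuousMap_lifts φ
    (a₀ := (0 : Fin 2 → ℝ)) (e₀ := Complex.log (φ 0)) (Subtype.ext (Complex.exp_log (φ 0).2))
  have hexp : ∀ p, Complex.exp (Φ p) = (F p 0 - a 0 : ℝ) + (F p 1 - a 1 : ℝ) * Complex.I :=
    fun p => congrArg Subtype.val (congrFun hΦ p)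
  have hexpγ : ∀ s : ℝ, Complex.exp (Φ (γ s)) = (ε / 2 : ℝ) * Complex.exp (s * Complex.I) := by
    intro s
    rw [hexp, hγ, Complex.exp_mul_I]
    simp [circ]
    ring
  have key : (fun s => Φ (γ s)) = fun s : ℝ => Φ (γ 0) + s * Complex.I := by
    refine Complex.isCoveringMap_exp.eq_of_comp_eq (by fun_prop) (by fun_prop) ?_ 0 (by simp)
    funext s
    refine Subtype.ext ?_
    simp only [Function.comp]
    rw [Complex.exp_add, hexpγ, hexpγ]
    simp
  have hper : γ (2 * Real.pi) = γ 0 := by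
    refine hinj ?_
    rw [hγ, hγ]
    simp [circ]
  have := congrFun key (2 * Real.pi)
  simp only [hper] at this
  simp [Real.pi_ne_zero] at this

lemma not_dvd_pderiv {h : MvPolynomial (Fin 2) ℝ} {i : Fin 2} (hi : pderiv i h ≠ 0) :
    ¬ h ∣ pderiv i h := by
  rintro ⟨k, hk⟩
  have hh : h ≠ 0 := by
    rintro rfl
    simp at hi
  have hk0 : k ≠ 0 := by
    rintro rfl
    simp [hk] at hi
  have hlt : ∀ m ∈ (pderiv i h).support, m i < degreeOf i h := by
    intro m hm
    rw [mem_support_iff, coeff_pderiv] at hm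
    have := monomial_le_degreeOf i (mem_support_iff.2 (left_ne_zero_of_mul hm))
    simpa [Nat.succ_le_iff] using this
  have hpos : 0 < degreeOf i h := by
    obtain ⟨m, hm⟩ := support_nonempty.2 hi
    exact (Nat.zero_le _).trans_lt (hlt m hm)
  have := (degreeOf_lt_iff hpos).2 hlt
  rw [hk, degreeOf_mul_eq hh hk0] at this
  omega

lemma exists_pderiv_ne_zero {h : MvPolynomial (Fin 2) ℝ} (hh : Irreducible h) :
    ∃ i, pderiv i h ≠ 0 := by
  by_contra! hall
  have hC : h = C (coeff 0 h) := by
    ext m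
    rw [coeff_C]
    split_ifs with hm
    · rw [hm]
    · obtain ⟨i, hi⟩ := Finsupp.ne_iff.1 (Ne.symm hm)
      have hle : Finsupp.single i 1 ≤ m := by
        rw [Finsupp.single_le_iff]
        exact Nat.one_le_iff_ne_zero.2 hi
      have := congrArg (coeff (m - Finsupp.single i 1)) (hall i)
      rw [coeff_pderiv, tsub_add_cancel_of_le hle, coeff_zero] at this
      exact (mul_eq_zero.1 this).resolve_right (by positivity)
  apply hh.not_isUnit
  rw [hC]
  refine (IsUnit.mk0 _ fun h0 => hh.ne_zero ?_).map C
  rw [hC, h0, map_zero]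

lemma finite_setOf_eval_eq_zero_of_semidefinite {h : MvPolynomial (Fin 2) ℝ} (hh : Irreducible h)
    (hs : (∀ q, 0 ≤ eval q h) ∨ ∀ q, eval q h ≤ 0) : {q : Fin 2 → ℝ | eval q h = 0}.Finite := by
  obtain ⟨i, hi⟩ := exists_pderiv_ne_zero hh
  refine (finite_setOf_eval_eq_zero hh (not_dvd_pderiv hi)).subset fun q hq => ⟨hq, ?_⟩
  have hq : eval q h = 0 := hq
  have hd := (hasStrictFDerivAt_eval h q).hasFDerivAt
  have h0 := hs.elim
    (fun hs => IsLocalMin.hasFDerivAt_eq_zero (f := fun q : Fin 2 → ℝ => eval q h)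
      (Filter.Eventually.of_forall fun q' => hq.trans_le (hs q')) hd)
    (fun hs => IsLocalMax.hasFDerivAt_eq_zero (f := fun q : Fin 2 → ℝ => eval q h)
      (Filter.Eventually.of_forall fun q' => (hs q').trans_eq hq.symm) hd)
  have := DFunLike.congr_fun h0 (Pi.single i 1)
  fin_cases i <;> simpa [Pi.single_apply] using this

/-- Near a point missed by a continuous map of dense range, one of two independent linear forms
is unbounded. -/
lemma unbounded_of_notMem_range {F : (Fin 2 → ℝ) → Fin 2 → ℝ} (hF : Continuous F)
    (hdense : DenseRange F) {q : Fin 2 → ℝ} (hq : q ∉ Set.range F) {c₁ c₂ : ℝ} (hc : c₁ ≠ c₂) :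
    (∀ V ∈ nhds q, ∀ M : ℝ, ∃ p, F p ∈ V ∧ M < |p 0 + c₁ * p 1|) ∨
      ∀ V ∈ nhds q, ∀ M : ℝ, ∃ p, F p ∈ V ∧ M < |p 0 + c₂ * p 1| := by
  by_contra! hcon
  obtain ⟨⟨V₁, hV₁, M₁, h₁⟩, V₂, hV₂, M₂, h₂⟩ := hcon
  have hsub : 0 < |c₁ - c₂| := abs_pos.2 (sub_ne_zero.2 hc)
  set B := (M₁ + M₂) / |c₁ - c₂| with hB
  set S := Metric.closedBall (0 : Fin 2 → ℝ) (max B (M₁ + |c₁| * B)) with hS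
  have hmem : ∀ p, F p ∈ V₁ ∩ V₂ → p ∈ S := by
    rintro p ⟨hp₁, hp₂⟩
    have e₁ := h₁ p hp₁
    have e₂ := h₂ p hp₂
    have b1 : |p 1| ≤ B := by
      rw [hB, le_div_iff₀ hsub, ← abs_mul]
      calc |p 1 * (c₁ - c₂)| = |(p 0 + c₁ * p 1) - (p 0 + c₂ * p 1)| := by ring_nf
        _ ≤ _ := (abs_sub _ _).trans (add_le_add e₁ e₂)
    have b0 : |p 0| ≤ M₁ + |c₁| * B := by
      calc |p 0| = |(p 0 + c₁ * p 1) - c₁ * p 1| := by ring_nf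
        _ ≤ |p 0 + c₁ * p 1| + |c₁ * p 1| := abs_sub _ _
        _ ≤ _ := by
          rw [abs_mul]
          gcongr
    rw [hS, mem_closedBall_zero_iff, pi_norm_le_iff_of_nonneg
      (((abs_nonneg _).trans b1).trans (le_max_left _ _))]
    intro i
    fin_cases i
    · exact b0.trans (le_max_right _ _)
    · exact b1.trans (le_max_left _ _)
  have hclosed : IsClosed (F '' S) := ((isCompact_closedBall _ _).image hF).isClosed
  have hqc : q ∈ closure (F '' S) := by
    rw [mem_closure_iff_nhds]
    intro V hV
    obtain ⟨x, hx⟩ := hdense.exists_mem_open isOpen_interior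
      ⟨q, mem_interior_iff_mem_nhds.2 (Filter.inter_mem hV (Filter.inter_mem hV₁ hV₂))⟩
    have hx := interior_subset hx
    exact ⟨F x, hx.1, x, hmem x hx.2, rfl⟩
  rw [hclosed.closure_eq] at hqc
  obtain ⟨p, -, hp⟩ := hqc
  exact hq ⟨p, hp⟩

section Surjective

variable {G : Fin 2 → MvPolynomial (Fin 2) ℝ}

lemma denseRange_polyMap (hG : AlgebraicIndependent ℝ G)
    (hinj : Function.Injective (polyMap G)) : DenseRange (polyMap G) := by
  obtain ⟨c, R, d, hR⟩ := (infinite_setOf_exists_isEliminant G hG).nonempty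
  exact (dense_setOf_eval_ne_zero hR.ne_zero).mono fun q hq => hR.mem_range hG hinj hq

lemma semidefinite_of_finite_range_inter (hinj : Function.Injective (polyMap G))
    (hdense : DenseRange (polyMap G)) {h : MvPolynomial (Fin 2) ℝ}
    (hfin : {q | q ∈ Set.range (polyMap G) ∧ eval q h = 0}.Finite) :
    (∀ q, 0 ≤ eval q h) ∨ ∀ q, eval q h ≤ 0 := by
  set T : Set (Fin 2 → ℝ) := {p | eval (polyMap G p) h = 0} with hT
  have hTfin : T.Finite := by
    refine Set.Finite.of_finite_image (f := polyMap G) (hfin.subset ?_) hinj.injOn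
    rintro _ ⟨p, hp, rfl⟩
    exact ⟨⟨p, rfl⟩, hp⟩
  have hrank : 1 < Module.rank ℝ (Fin 2 → ℝ) := by
    rw [rank_fin_fun]
    exact_mod_cast one_lt_two
  have hconn := (hTfin.countable.isConnected_compl_of_one_lt_rank hrank).isPreconnected
  have hcont : Continuous fun p => eval (polyMap G p) h :=
    (MvPolynomial.continuous_eval h).comp (continuous_polyMap G)
  have hsign : (∀ p, 0 ≤ eval (polyMap G p) h) ∨ ∀ p, eval (polyMap G p) h ≤ 0 := by
    by_contra! hcon
    obtain ⟨⟨p, hp⟩, p', hp'⟩ := hcon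
    obtain ⟨x, hx, hx0⟩ := hconn.intermediate_value (a := p) (b := p') hp.ne hp'.ne'
      hcont.continuousOn ⟨hp.le, hp'.le⟩
    exact hx hx0
  refine hsign.imp (fun hs q => ?_) fun hs q => ?_
  · exact hdense.induction_on q
      (isClosed_le continuous_const (MvPolynomial.continuous_eval h)) hs
  · exact hdense.induction_on q
      (isClosed_le (MvPolynomial.continuous_eval h) continuous_const) hs

lemma finite_notMem_range_and_eval_eq_zero (hG : AlgebraicIndependent ℝ G)
    (hinj : Function.Injective (polyMap G)) {h : MvPolynomial (Fin 2) ℝ} (hh : Irreducible h) :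
    {q | q ∉ Set.range (polyMap G) ∧ eval q h = 0}.Finite := by
  have hdense := denseRange_polyMap hG hinj
  have hred : ∀ c : ℝ, (∃ R d, IsEliminant G (X 0 + C c * X 1) R d) →
      ∃ (R : Polynomial (MvPolynomial (Fin 2) ℝ)) (n : ℕ) (e : MvPolynomial (Fin 2) ℝ),
        ChangesSignAt G (X 0 + C c * X 1) R ∧ ¬ h ∣ e ∧
        ∀ q, eval q h = 0 → eval q e ≠ 0 →
          specialize q R ≠ 0 ∧ (specialize q R).natDegree = n := by
    rintro c ⟨R, d, hR⟩
    have hR0 : R ≠ 0 := by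
      rintro rfl
      obtain ⟨q, hq⟩ := (dense_setOf_eval_ne_zero hR.ne_zero).nonempty
      exact hR.specialize_ne_zero q hq (by simp)
    obtain ⟨b, R', n, e, hb, rfl, he, hq⟩ := exists_reduction hh hR0
    exact ⟨R', n, e, (hR.changesSignAt hG hinj).of_mul hG hb, he, hq⟩
  obtain ⟨c₁, hc₁, c₂, hc₂, hc⟩ := (infinite_setOf_exists_isEliminant G hG).nontrivial
  obtain ⟨R₁, n₁, e₁, hs₁, he₁, hq₁⟩ := hred c₁ hc₁
  obtain ⟨R₂, n₂, e₂, hs₂, he₂, hq₂⟩ := hred c₂ hc₂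
  have hodd : ∀ {c R n e}, ChangesSignAt G (X 0 + C c * X 1) R → ¬ h ∣ e →
      (∀ q, eval q h = 0 → eval q e ≠ 0 → specialize q R ≠ 0 ∧ (specialize q R).natDegree = n) →
      ¬ Odd n → {q : Fin 2 → ℝ | eval q h = 0}.Finite := by
    intro c R n e hs he hq hn
    refine finite_setOf_eval_eq_zero_of_semidefinite hh
      (semidefinite_of_finite_range_inter hinj hdense
        ((finite_setOf_eval_eq_zero hh he).subset ?_))
    rintro _ ⟨⟨p, rfl⟩, hp⟩
    refine ⟨hp, ?_⟩
    by_contra hne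
    obtain ⟨h0, hdeg⟩ := hq _ hp hne
    exact hn (hdeg ▸ hs.odd_natDegree p h0)
  by_cases hn₁ : Odd n₁
  swap
  · exact (hodd hs₁ he₁ hq₁ hn₁).subset fun q hq => hq.2
  by_cases hn₂ : Odd n₂
  swap
  · exact (hodd hs₂ he₂ hq₂ hn₂).subset fun q hq => hq.2
  refine ((finite_setOf_eval_eq_zero hh he₁).union (finite_setOf_eval_eq_zero hh he₂)).subset ?_
  rintro q ⟨hq, hqh⟩
  by_contra hnot
  simp only [Set.mem_union, Set.mem_ofPred_eq, hqh, true_and, not_or] at hnot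
  obtain ⟨h0₁, hd₁⟩ := hq₁ q hqh hnot.1
  obtain ⟨h0₂, hd₂⟩ := hq₂ q hqh hnot.2
  rcases unbounded_of_notMem_range (continuous_polyMap G) hdense hq hc with hu | hu
  · have := hs₁.even_natDegree q h0₁ (by simpa using hu)
    rw [hd₁] at this
    exact Nat.not_even_iff_odd.2 hn₁ this
  · have := hs₂.even_natDegree q h0₂ (by simpa using hu)
    rw [hd₂] at this
    exact Nat.not_even_iff_odd.2 hn₂ this

lemma finite_compl_range_polyMap (hG : AlgebraicIndependent ℝ G)
    (hinj : Function.Injective (polyMap G)) : (Set.range (polyMap G))ᶜ.Finite := by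
  obtain ⟨c, R, d, hR⟩ := (infinite_setOf_exists_isEliminant G hG).nonempty
  have key : ∀ e : MvPolynomial (Fin 2) ℝ, e ≠ 0 →
      {q | q ∉ Set.range (polyMap G) ∧ eval q e = 0}.Finite := by
    intro e
    refine WfDvdMonoid.induction_on_irreducible e (fun h => absurd rfl h) (fun u hu _ => ?_)
      fun a h _ hh ih hne => ?_
    · refine Set.finite_empty.subset ?_
      rintro q ⟨-, hq⟩
      exact ((hu.map (eval q)).ne_zero hq).elim
    · refine ((finite_notMem_range_and_eval_eq_zero hG hinj hh).union
        (ih (right_ne_zero_of_mul hne))).subset ?_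
      rintro q ⟨hq, hq0⟩
      rw [map_mul, mul_eq_zero] at hq0
      exact hq0.imp (⟨hq, ·⟩) (⟨hq, ·⟩)
  refine (key d hR.ne_zero).subset fun q hq => ⟨hq, ?_⟩
  by_contra hne
  exact hq (hR.mem_range hG hinj hne)

lemma surjective_polyMap (hJ : ∀ p, eval p (Jac (G 0) (G 1)) ≠ 0)
    (hinj : Function.Injective (polyMap G)) : Function.Surjective (polyMap G) := by
  intro a
  refine mem_range_of_eventually_mem_range (continuous_polyMap G) (isOpenMap_polyMap hJ) hinj ?_
  have hfin := finite_compl_range_polyMap (algebraicIndependent_of_jac_ne_zero hJ) hinj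
  have hev := ((hfin.subset Set.sdiff_subset).isClosed (X := Fin 2 → ℝ)
    (s := (Set.range (polyMap G))ᶜ \ {a})).isOpen_compl.mem_nhds (x := a) (by simp)
  filter_upwards [nhdsWithin_le_nhds hev, self_mem_nhdsWithin] with q hq hqa
  by_contra hnot
  exact hq ⟨hnot, hqa⟩

end Surjective

section LevelSets

variable {G : Fin 2 → MvPolynomial (Fin 2) ℝ}

lemma isPreconnected_level_set (hJ : ∀ p, eval p (Jac (G 0) (G 1)) ≠ 0)
    (hinj : Function.Injective (polyMap G)) (t : ℝ) :
    IsPreconnected {p : Fin 2 → ℝ | eval p (G 0) = t} := by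
  let e : (Fin 2 → ℝ) ≃ₜ (Fin 2 → ℝ) :=
    (Equiv.ofBijective _ ⟨hinj, surjective_polyMap hJ hinj⟩).toHomeomorphOfContinuousOpen
      (continuous_polyMap G) (isOpenMap_polyMap hJ)
  have hconv : Convex ℝ {q : Fin 2 → ℝ | q 0 = t} :=
    convex_hyperplane (LinearMap.proj (R := ℝ) (φ := fun _ : Fin 2 => ℝ) 0).isLinear t
  have heq : {p : Fin 2 → ℝ | eval p (G 0) = t} = e ⁻¹' {q | q 0 = t} := rfl
  rw [heq, ← e.image_symm]
  exact hconv.isPreconnected.image _ e.symm.continuous.continuousOn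

/-- A section of `polyMap G` over an open interval of the line `q 0 = t`. -/
structure IsLineSection (G : Fin 2 → MvPolynomial (Fin 2) ℝ) (t : ℝ) (I : Set ℝ)
    (σ : ℝ → Fin 2 → ℝ) : Prop where
  isOpen : IsOpen I
  isPreconnected : IsPreconnected I
  continuousOn : ContinuousOn σ I
  polyMap_eq : ∀ v ∈ I, polyMap G (σ v) = ![t, v]

lemma IsLineSection.exists_union (hJ : ∀ p, eval p (Jac (G 0) (G 1)) ≠ 0) {t : ℝ} {I J : Set ℝ}
    {σ τ : ℝ → Fin 2 → ℝ} (hσ : IsLineSection G t I σ) (hτ : IsLineSection G t J τ) {v : ℝ}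
    (hvI : v ∈ I) (hvJ : v ∈ J) (hv : σ v = τ v) :
    ∃ ρ, IsLineSection G t (I ∪ J) ρ ∧ Set.EqOn ρ σ I ∧ Set.EqOn ρ τ J := by
  classical
  have hIJ : IsPreconnected (I ∩ J) :=
    (hσ.isPreconnected.ordConnected.inter hτ.isPreconnected.ordConnected).isPreconnected
  have heq : Set.EqOn σ τ (I ∩ J) :=
    (T2Space.isSeparatedMap (polyMap G)).eqOn_of_comp_eqOn (isLocallyInjective_polyMap hJ) hIJ
      (hσ.continuousOn.mono Set.inter_subset_left) (hτ.continuousOn.mono Set.inter_subset_right)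
      (fun w hw => (hσ.polyMap_eq w hw.1).trans (hτ.polyMap_eq w hw.2).symm) ⟨hvI, hvJ⟩ hv
  have h1 : Set.EqOn (I.piecewise σ τ) σ I := Set.piecewise_eqOn I σ τ
  have h2 : Set.EqOn (I.piecewise σ τ) τ J := by
    intro w hw
    by_cases hwI : w ∈ I
    · rw [Set.piecewise_eq_of_mem _ _ _ hwI, heq ⟨hwI, hw⟩]
    · rw [Set.piecewise_eq_of_notMem _ _ _ hwI]
  refine ⟨I.piecewise σ τ, ⟨hσ.isOpen.union hτ.isOpen,
    hσ.isPreconnected.union v hvI hvJ hτ.isPreconnected,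
    (hσ.continuousOn.congr h1).union_of_isOpen (hτ.continuousOn.congr h2) hσ.isOpen hτ.isOpen,
    ?_⟩, h1, h2⟩
  rintro w (hw | hw)
  · rw [h1 hw, hσ.polyMap_eq w hw]
  · rw [h2 hw, hτ.polyMap_eq w hw]

lemma exists_isLineSection (hJ : ∀ p, eval p (Jac (G 0) (G 1)) ≠ 0) (x : Fin 2 → ℝ) :
    ∃ I σ, IsLineSection G (eval x (G 0)) I σ ∧ ∀ᶠ y in nhds x,
      eval y (G 0) = eval x (G 0) → eval y (G 1) ∈ I ∧ σ (eval y (G 1)) = y := by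
  obtain ⟨e, he⟩ := exists_hasStrictFDerivAt_polyMap (hJ x)
  set φ := he.toOpenPartialHomeomorph (polyMap G) with hφ
  have hcoe : ⇑φ = polyMap G := he.toOpenPartialHomeomorph_coe
  have hxs : x ∈ φ.source := he.mem_toOpenPartialHomeomorph_source
  have hline : Continuous fun v : ℝ => (![eval x (G 0), v] : Fin 2 → ℝ) := by
    refine continuous_pi fun i => ?_
    fin_cases i
    · exact continuous_const
    · exact continuous_id
  have hpoly : ∀ y, eval y (G 0) = eval x (G 0) →
      polyMap G y = ![eval x (G 0), eval y (G 1)] := by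
    intro y hy
    funext i
    fin_cases i
    · exact hy
    · rfl
  have hopen := φ.open_target.preimage hline
  have hmem : eval x (G 1) ∈ (fun v : ℝ => (![eval x (G 0), v] : Fin 2 → ℝ)) ⁻¹' φ.target := by
    rw [Set.mem_preimage, ← hpoly x rfl, ← hcoe]
    exact φ.map_source hxs
  obtain ⟨ε, hε, hball⟩ := Metric.isOpen_iff.1 hopen _ hmem
  refine ⟨Metric.ball (eval x (G 1)) ε, fun v => φ.symm ![eval x (G 0), v],
    ⟨Metric.isOpen_ball, (convex_ball _ _).isPreconnected,
      φ.continuousOn_symm.comp hline.continuousOn fun v hv => hball hv, fun v hv => ?_⟩, ?_⟩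
  · rw [← hcoe]
    exact φ.right_inv (hball hv)
  · filter_upwards [φ.open_source.mem_nhds hxs, (MvPolynomial.continuous_eval (G 1)).continuousAt
      (Metric.ball_mem_nhds (eval x (G 1)) hε)] with y hys hyb hy
    refine ⟨hyb, ?_⟩
    rw [← hpoly y hy, ← hcoe]
    exact φ.left_inv hys

lemma injective_of_isPreconnected_level_sets (hJ : ∀ p, eval p (Jac (G 0) (G 1)) ≠ 0)
    (hL : ∀ t : ℝ, IsPreconnected {p : Fin 2 → ℝ | eval p (G 0) = t}) :
    Function.Injective (polyMap G) := by
  intro a b hab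
  have h0 : eval a (G 0) = eval b (G 0) := congrFun hab 0
  have h1 : eval a (G 1) = eval b (G 1) := congrFun hab 1
  set t := eval b (G 0) with ht
  obtain ⟨I, σ, hσ, ⟨v, hv, rfl⟩, w, hw, hwb⟩ : ∃ I σ, IsLineSection G t I σ ∧ a ∈ σ '' I ∧
      b ∈ σ '' I := by
    refine (hL t).induction₂ (fun a b => ∃ I σ, IsLineSection G t I σ ∧ a ∈ σ '' I ∧ b ∈ σ '' I)
      (fun x hx => ?_) ?_ (fun x y _ _ ⟨I, σ, hσ, hx, hy⟩ => ⟨I, σ, hσ, hy, hx⟩) h0 ht.symm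
    · obtain ⟨I, σ, hσ, hev⟩ := exists_isLineSection hJ x
      rw [show eval x (G 0) = t from hx] at hσ hev
      have hself := hev.self_of_nhds hx
      filter_upwards [nhdsWithin_le_nhds hev, self_mem_nhdsWithin] with y hy hyL
      exact ⟨I, σ, hσ, ⟨_, hself⟩, ⟨_, hy hyL⟩⟩
    · rintro x y z - - - ⟨I, σ, hσ, ⟨u, hu, rfl⟩, v, hv, rfl⟩ ⟨J, τ, hτ, ⟨v', hv', hvv⟩, w, hw, rfl⟩
      have hveq : v' = v := by
        have := (hτ.polyMap_eq v' hv').symm.trans ((congrArg _ hvv).trans (hσ.polyMap_eq v hv))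
        simpa using congrFun this 1
      subst hveq
      obtain ⟨ρ, hρ, hρσ, hρτ⟩ := hσ.exists_union hJ hτ hv hv' hvv.symm
      exact ⟨_, ρ, hρ, ⟨u, Or.inl hu, hρσ hu⟩, w, Or.inr hw, hρτ hw⟩
  have e1 := congrFun (hσ.polyMap_eq v hv) 1
  have e2 := congrFun (hσ.polyMap_eq w hw) 1
  rw [hwb] at e2
  have : v = w := e1.symm.trans (h1.trans e2)
  rw [this, hwb]

end LevelSets

theorem injective_iff_level_sets_connected (f g : MvPolynomial (Fin 2) ℝ)
    (hJ : (∀ p : Fin 2 → ℝ, 0 < eval p (Jac f g)) ∨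
          (∀ p : Fin 2 → ℝ, eval p (Jac f g) < 0)) :
    Function.Injective (fun p : Fin 2 → ℝ => (eval p f, eval p g)) ↔
      ∀ t : ℝ, IsPreconnected {p : Fin 2 → ℝ | eval p f = t} := by
  have hJ' : ∀ p, eval p (Jac ((![f, g] : Fin 2 → _) 0) ((![f, g] : Fin 2 → _) 1)) ≠ 0 :=
    fun p => hJ.elim (fun h => (h p).ne') fun h => (h p).ne
  refine ⟨fun hinj => isPreconnected_level_set (G := ![f, g]) hJ' fun a b hab => hinj ?_,
    fun hL a b hab => injective_of_isPreconnected_level_sets (G := ![f, g]) hJ' hL ?_⟩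
  · exact Prod.ext (congrFun hab 0) (congrFun hab 1)
  · funext i
    fin_cases i
    · exact congrArg Prod.fst hab
    · exact congrArg Prod.snd hab
end

section
/- Let f ∈ ℝ[x,y] be a convenient polynomial (some positive power of x and some positive power of y occur in f) without critical points. If f is non-degenerated on every outer edge of its Newton polygon, then every level set f⁻¹(t) is connected. -/
open MvPolynomial

open Classical in
/-- The symbolic restriction of `h` to the face of its Newton polygon in direction `ξ`. -/
noncomputable def face (ξ : ℝ × ℝ) (h : MvPolynomial (Fin 2) ℝ) : MvPolynomial (Fin 2) ℝ :=
  ∑ m ∈ h.support.filter (fun m => ∀ m' ∈ h.support,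
      ξ.1 * (m' 0 : ℝ) + ξ.2 * (m' 1 : ℝ) ≤ ξ.1 * (m 0 : ℝ) + ξ.2 * (m 1 : ℝ)),
    monomial m (h.coeff m)

open Filter Topology

/-- If a real function increases at unit speed along a bounded `C¹` vector field, then the flow of
the field retracts the space onto each level set, which is thus connected. -/
theorem isPreconnected_level_of_bounded_unit_speed_field {E : Type*} [NormedAddCommGroup E]
    [NormedSpace ℝ E] [ProperSpace E] (g : E → ℝ) (g' : E → E →L[ℝ] ℝ)
    (hg : ∀ x, HasFDerivAt g (g' x) x) (V : E → E) (hV : ContDiff ℝ 1 V) (L : NNReal)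
    (hL : ∀ x, ‖V x‖ ≤ L) (hgV : ∀ x, g' x (V x) = 1) (t : ℝ) :
    IsPreconnected {x | g x = t} := by
  have hgc : Continuous g := continuous_iff_continuousAt.2 fun x => (hg x).continuousAt
  refine isPreconnected_of_forall_pair fun p hp q hq => ?_
  have hsc : IsCompact (segment ℝ p q) := by
    rw [segment_eq_image_lineMap]
    exact isCompact_Icc.image AffineMap.lineMap_continuous
  obtain ⟨r, hr⟩ : ∃ r : NNReal, segment ℝ p q ⊆ Metric.closedBall 0 r := by
    obtain ⟨r, hr⟩ := hsc.isBounded.subset_closedBall 0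
    exact ⟨r.toNNReal, hr.trans (Metric.closedBall_subset_closedBall (Real.le_coe_toNNReal r))⟩
  obtain ⟨T, hT⟩ : ∃ T : NNReal, ∀ x ∈ segment ℝ p q, |t - g x| ≤ T := by
    obtain ⟨T, hT⟩ := hsc.exists_bound_of_continuousOn (f := fun x => t - g x)
      (by fun_prop)
    exact ⟨T.toNNReal, fun x hx => (hT x hx).trans (Real.le_coe_toNNReal T)⟩
  obtain ⟨K, hK⟩ := hV.locallyLipschitz.locallyLipschitzOn.exists_lipschitzOnWith_of_compact
    (isCompact_closedBall (0 : E) (L * T + r : NNReal))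
  have h0 : (0 : ℝ) ∈ Set.Icc (-(T : ℝ)) T := by simp
  have hPL : IsPicardLindelof (fun _ => V) (⟨0, h0⟩ : Set.Icc (-(T : ℝ)) T) 0
      (L * T + r) r L K :=
    .of_time_independent (fun x _ => hL x) hK (by simp)
  obtain ⟨α, hα, hαc⟩ := hPL.exists_forall_mem_closedBall_eq_hasDerivWithinAt_continuousOn
  have hflow : ∀ x ∈ Metric.closedBall (0 : E) r, ∀ s ∈ Set.Icc (-(T : ℝ)) T,
      g (α (x, s)) = g x + s := by
    intro x hx s hs
    have hd : ∀ u ∈ Set.Icc (-(T : ℝ)) T,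
        HasDerivWithinAt (fun u => g (α (x, u)) - u) 0 (Set.Icc (-(T : ℝ)) T) u := by
      intro u hu
      have h1 := ((hg _).comp_hasDerivWithinAt u ((hα x hx).2 u hu)).sub
        (hasDerivWithinAt_id u _)
      rw [hgV, sub_self] at h1
      exact h1
    have := (convex_Icc (-(T : ℝ)) T).norm_image_sub_le_of_norm_hasDerivWithin_le (C := 0) hd
      (by simp) h0 hs
    have hx0 : α (x, 0) = x := (hα x hx).1
    rw [zero_mul, norm_le_zero_iff, hx0] at this
    linarith
  have hmem : ∀ x ∈ segment ℝ p q, t - g x ∈ Set.Icc (-(T : ℝ)) T := fun x hx =>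
    abs_le.1 (hT x hx)
  have hfix : ∀ x ∈ segment ℝ p q, g x = t → α (x, t - g x) = x := by
    intro x hx h
    rw [h, sub_self]
    exact (hα x (hr hx)).1
  refine ⟨(fun x => α (x, t - g x)) '' segment ℝ p q, ?_,
    ⟨p, left_mem_segment ℝ p q, hfix p (left_mem_segment ℝ p q) hp⟩,
    ⟨q, right_mem_segment ℝ p q, hfix q (right_mem_segment ℝ p q) hq⟩, ?_⟩
  · rintro _ ⟨x, hx, rfl⟩
    have := hflow x (hr hx) _ (hmem x hx)
    simp only [Set.mem_ofPred_eq]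
    rw [this]; ring
  · refine (convex_segment p q).isPreconnected.image _ ?_
    refine hαc.comp (by fun_prop) fun x hx => ⟨hr hx, hmem x hx⟩

theorem MvPolynomial.hasFDerivAt_eval {σ : Type*} [Fintype σ] (f : MvPolynomial σ ℝ) (p : σ → ℝ) :
    HasFDerivAt (fun p => eval p f)
      (∑ i, eval p (pderiv i f) • (ContinuousLinearMap.proj i : (σ → ℝ) →L[ℝ] ℝ)) p := by
  classical
  induction f using MvPolynomial.induction_on with
  | C a => simpa using hasFDerivAt_const a p
  | add f g hf hg =>
    simp only [map_add, add_smul, Finset.sum_add_distrib]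
    exact hf.add hg
  | mul_X f i hf =>
    have h := hf.mul (hasFDerivAt_apply i p)
    simp only [map_mul, eval_X]
    refine h.congr_fderiv ?_
    ext v
    simp [Derivation.leibniz, pderiv_X, Pi.single_apply, Finset.sum_add_distrib, add_mul,
      Finset.mul_sum, apply_ite, mul_assoc]

theorem isPreconnected_level_of_gradient_bounded_below (f : MvPolynomial (Fin 2) ℝ) {c : ℝ}
    (hc : 0 < c) (hf : ∀ p, c ≤ eval p (pderiv 0 f) ^ 2 + eval p (pderiv 1 f) ^ 2) (t : ℝ) :
    IsPreconnected {p : Fin 2 → ℝ | eval p f = t} := by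
  set D : (Fin 2 → ℝ) → ℝ := fun p => eval p (pderiv 0 f) ^ 2 + eval p (pderiv 1 f) ^ 2 with hD
  have hD0 : ∀ p, 0 < D p := fun p => hc.trans_le (hf p)
  have hsmooth : ∀ g : MvPolynomial (Fin 2) ℝ, ContDiff ℝ 1 fun p : Fin 2 → ℝ => eval p g :=
    fun g => (AnalyticOnNhd.eval_mvPolynomial g).contDiff
  have hDs : ContDiff ℝ 1 D := ((hsmooth _).pow 2).add ((hsmooth _).pow 2)
  refine isPreconnected_level_of_bounded_unit_speed_field _ _ (hasFDerivAt_eval f)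
    (fun p i => eval p (pderiv i f) / D p)
    (contDiff_pi.2 fun i => (hsmooth _).div hDs fun p => (hD0 p).ne')
    (Real.toNNReal (√c)⁻¹) (fun p => ?_) (fun p => ?_) t
  · rw [Real.coe_toNNReal _ (by positivity), pi_norm_le_iff_of_nonneg (by positivity)]
    intro i
    have hi : |eval p (pderiv i f)| ≤ √(D p) := by
      rw [← Real.sqrt_sq_eq_abs]
      apply Real.sqrt_le_sqrt
      fin_cases i <;> simp [hD, sq_nonneg]
    rw [norm_div, Real.norm_eq_abs, Real.norm_of_nonneg (hD0 p).le]
    calc _ ≤ √(D p) / D p := by gcongr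
      _ = (√(D p))⁻¹ := Real.sqrt_div_self
      _ ≤ _ := inv_anti₀ (Real.sqrt_pos.2 hc) (Real.sqrt_le_sqrt (hf p))
  · have := (hD0 p).ne'
    simp only [Fin.sum_univ_two, add_apply, smul_apply,
      ContinuousLinearMap.proj_apply, smul_eq_mul]
    field_simp
    rfl

/-- A binomial `X ^ a - τ X ^ b` with coprime terms is divisible by no variable. -/
theorem not_X_dvd_monomial_sub {σ : Type*} {a b : σ →₀ ℕ} (hab : a ≠ b) {τ : ℝ} (hτ : τ ≠ 0)
    {i : σ} (hi : a i = 0 ∨ b i = 0) :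
    ¬ (X i ∣ (monomial a 1 - monomial b τ : MvPolynomial σ ℝ)) := by
  classical
  rintro ⟨q, hq⟩
  have ha := congr_arg (coeff a) hq
  have hb := congr_arg (coeff b) hq
  rw [coeff_X_mul', coeff_sub, coeff_monomial, coeff_monomial] at ha hb
  rcases hi with hi | hi
  · simp [hi, hab.symm] at ha
  · simp [hi, hab, hτ] at hb

theorem not_isUnit_monomial_sub {σ : Type*} {a b : σ →₀ ℕ} (hab : a ≠ b) {τ : ℝ} (hτ : τ ≠ 0) :
    ¬ IsUnit (monomial a 1 - monomial b τ : MvPolynomial σ ℝ) := by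
  classical
  rw [MvPolynomial.isUnit_iff_eq_C_of_isReduced]
  rintro ⟨r, -, hr⟩
  have ha := congr_arg (coeff a) hr
  have hb := congr_arg (coeff b) hr
  rw [coeff_C, coeff_sub, coeff_monomial, coeff_monomial] at ha hb
  by_cases h : 0 = a
  · have h' : 0 ≠ b := fun h' => hab (h.symm.trans h')
    simp [hab, h', hτ] at hb
  · simp [hab.symm, h] at ha

theorem Polynomial.sub_C_sq_dvd {g : Polynomial ℝ} {τ : ℝ} (h0 : g.eval τ = 0)
    (h1 : g.derivative.eval τ = 0) : (Polynomial.X - Polynomial.C τ) ^ 2 ∣ g := by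
  rcases eq_or_ne g 0 with rfl | hg
  · simp
  · exact (Polynomial.le_rootMultiplicity_iff hg).1
      ((Polynomial.one_lt_rootMultiplicity_iff_isRoot hg).2 ⟨h0, h1⟩)

theorem homogenize_dvd_of_natDegree_le {p g : Polynomial ℝ} {N : ℕ} (hpg : p ∣ g) (hg : g ≠ 0)
    (hN : g.natDegree ≤ N) : p.homogenize p.natDegree ∣ g.homogenize N := by
  obtain ⟨h, rfl⟩ := hpg
  have := Polynomial.natDegree_mul (left_ne_zero_of_mul hg) (right_ne_zero_of_mul hg)
  obtain ⟨M, rfl⟩ : ∃ M, N = p.natDegree + M := ⟨N - p.natDegree, by omega⟩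
  rw [Polynomial.homogenize_mul _ _ le_rfl (by omega)]
  exact dvd_mul_right _ _

/-- A double nonzero root of the univariate polynomial attached to an edge gives a multiple
factor, prime to the coordinates, of the restriction to this edge. -/
theorem exists_sq_dvd_of_double_root {F : Finset (Fin 2 →₀ ℕ)} {c : (Fin 2 →₀ ℕ) → ℝ}
    {j : (Fin 2 →₀ ℕ) → ℕ} {N : ℕ} {B e : Fin 2 → ℤ} (he : e ≠ 0) (hB : ∀ i, 0 ≤ B i)
    (hBN : ∀ i, 0 ≤ B i + N * e i) (hj : ∀ m ∈ F, j m ≤ N)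
    (hm : ∀ m ∈ F, ∀ i, (m i : ℤ) = B i + j m * e i) {τ : ℝ} (hτ : τ ≠ 0)
    (h0 : ∑ m ∈ F, c m * τ ^ j m = 0) (h1 : ∑ m ∈ F, c m * j m * τ ^ j m = 0) :
    ∃ k : MvPolynomial (Fin 2) ℝ, ¬ IsUnit k ∧ ¬ (X 0 ∣ k) ∧ ¬ (X 1 ∣ k) ∧
      k ^ 2 ∣ ∑ m ∈ F, monomial m (c m) := by
  set a : Fin 2 →₀ ℕ := Finsupp.equivFunOnFinite.symm fun i => (e i).toNat with ha
  set b : Fin 2 →₀ ℕ := Finsupp.equivFunOnFinite.symm fun i => (-e i).toNat with hb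
  set s : Fin 2 →₀ ℕ := Finsupp.equivFunOnFinite.symm fun i =>
    (B i - N * (-e i).toNat).toNat with hs
  have hab : a ≠ b := by
    intro h
    refine he (funext fun i => ?_)
    have := DFunLike.congr_fun h i
    simp only [ha, hb, Finsupp.equivFunOnFinite_symm_apply_apply] at this
    simp only [Pi.zero_apply]
    omega
  have hab0 : ∀ i, a i = 0 ∨ b i = 0 := by
    intro i
    simp only [ha, hb, Finsupp.equivFunOnFinite_symm_apply_apply]
    omega
  refine ⟨monomial a 1 - monomial b τ, not_isUnit_monomial_sub hab hτ,
    not_X_dvd_monomial_sub hab hτ (hab0 0), not_X_dvd_monomial_sub hab hτ (hab0 1), ?_⟩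
  set g : Polynomial ℝ := ∑ m ∈ F, Polynomial.monomial (j m) (c m) with hg
  have hsum : ∑ m ∈ F, monomial m (c m) =
      monomial s 1 * aeval ![monomial a (1 : ℝ), monomial b (1 : ℝ)] (g.homogenize N) := by
    rw [hg, Polynomial.homogenize_finsetSum, map_sum, Finset.mul_sum]
    refine Finset.sum_congr rfl fun m hmF => ?_
    rw [Polynomial.homogenize_monomial (hj m hmF), aeval_monomial,
      Finsupp.prod_fintype _ _ (by simp), Fin.prod_univ_two]
    have hsm : m = s + (j m • a + (N - j m) • b) := by
      ext i
      have h2 := hm m hmF i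
      have h3 := hj m hmF
      have h4 := hB i
      have h5 := hBN i
      simp only [ha, hb, hs, Finsupp.equivFunOnFinite_symm_apply_apply, Finsupp.add_apply,
        Finsupp.smul_apply, smul_eq_mul]
      zify [h3]
      rcases le_total 0 (e i) with h | h
      · have : (-e i).toNat = 0 := by omega
        rw [this]
        simp only [Nat.cast_zero, mul_zero, sub_zero, add_zero]
        rw [Int.toNat_of_nonneg h, Int.toNat_of_nonneg h4, h2]
      · have : (e i).toNat = 0 := by omega
        rw [this, Int.toNat_of_nonneg (by omega : 0 ≤ -e i), Int.toNat_of_nonneg (by linarith), h2]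
        push_cast
        ring
    rw [congrArg (fun x => monomial x (c m)) hsm]
    simp [monomial_pow, monomial_mul, MvPolynomial.C_mul_monomial, MvPolynomial.algebraMap_eq]
  rw [hsum]
  refine Dvd.dvd.mul_left ?_ _
  rcases eq_or_ne g 0 with hg0 | hg0
  · simp [hg0]
  have hdvd : (Polynomial.X - Polynomial.C τ) ^ 2 ∣ g := by
    refine Polynomial.sub_C_sq_dvd ?_ ?_
    · simpa [hg, Polynomial.eval_finsetSum] using h0
    · have : τ * g.derivative.eval τ = 0 := by
        rw [← h1, hg, Polynomial.derivative_sum, Polynomial.eval_finsetSum, Finset.mul_sum]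
        refine Finset.sum_congr rfl fun m _ => ?_
        rw [Polynomial.derivative_monomial, Polynomial.eval_monomial]
        rcases Nat.eq_zero_or_pos (j m) with h | h
        · simp [h]
        · conv_rhs => rw [← Nat.sub_add_cancel h, pow_succ]
          rw [Nat.sub_add_cancel h]; ring
      exact (mul_eq_zero.1 this).resolve_left hτ
  have hN : g.natDegree ≤ N := by
    refine Polynomial.natDegree_sum_le_of_forall_le _ _ fun m hmF => ?_
    exact (Polynomial.natDegree_monomial_le _).trans (hj m hmF)
  have h := homogenize_dvd_of_natDegree_le hdvd hg0 hN
  rw [Polynomial.natDegree_pow, Polynomial.natDegree_X_sub_C, mul_one, pow_two,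
    Polynomial.homogenize_mul (m := 1) (n := 1) _ _ (Polynomial.natDegree_X_sub_C_le τ)
      (Polynomial.natDegree_X_sub_C_le τ)] at h
  replace h := map_dvd (aeval ![monomial a (1 : ℝ), monomial b (1 : ℝ)]) h
  simpa [pow_two, MvPolynomial.C_mul_monomial, MvPolynomial.algebraMap_eq] using h

theorem Ultrafilter.exists_tendsto_of_abs_le {α : Type*} (U : Ultrafilter α) {g : α → ℝ} {C : ℝ}
    (h : ∀ᶠ x in U, |g x| ≤ C) : ∃ a, Tendsto g U (𝓝 a) := by
  obtain ⟨a, -, ha⟩ := (isCompact_Icc (a := -C) (b := C)).ultrafilter_le_nhds (U.map g)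
    (le_principal_iff.2 (h.mono fun x hx => abs_le.1 hx))
  exact ⟨a, ha⟩

/-- The value at `p` of the monomial with exponent `m`. -/
noncomputable def monomialValue (p : Fin 2 → ℝ) (m : Fin 2 →₀ ℕ) : ℝ := p 0 ^ m 0 * p 1 ^ m 1

theorem monomialValue_ne_zero {p : Fin 2 → ℝ} (hp : ∀ i, p i ≠ 0) (m : Fin 2 →₀ ℕ) :
    monomialValue p m ≠ 0 :=
  mul_ne_zero (pow_ne_zero _ (hp 0)) (pow_ne_zero _ (hp 1))

theorem log_abs_monomialValue {p : Fin 2 → ℝ} (hp : ∀ i, p i ≠ 0) (m : Fin 2 →₀ ℕ) :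
    Real.log |monomialValue p m| = m 0 * Real.log |p 0| + m 1 * Real.log |p 1| := by
  rw [monomialValue, abs_mul, abs_pow, abs_pow, Real.log_mul, Real.log_pow, Real.log_pow]
  · exact pow_ne_zero _ (abs_ne_zero.2 (hp 0))
  · exact pow_ne_zero _ (abs_ne_zero.2 (hp 1))

theorem monomialValue_div_eq_zpow {p : Fin 2 → ℝ} (hp : ∀ i, p i ≠ 0) {m m' : Fin 2 →₀ ℕ}
    {e : Fin 2 → ℤ} {k : ℤ} (h : ∀ i, (m i : ℤ) - m' i = k * e i) :
    monomialValue p m / monomialValue p m' = (p 0 ^ e 0 * p 1 ^ e 1) ^ k := by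
  have key : ∀ i, p i ^ m i = p i ^ m' i * (p i ^ e i) ^ k := by
    intro i
    rw [← zpow_natCast, ← zpow_natCast, ← zpow_mul, ← zpow_add₀ (hp i)]
    congr 1
    linarith [h i, mul_comm k (e i)]
  rw [div_eq_iff (monomialValue_ne_zero hp m'), monomialValue, monomialValue, key 0, key 1, mul_zpow]
  ring

theorem exists_primitive_multiple {d : Fin 2 → ℤ} (hd : d ≠ 0) :
    ∃ (e : Fin 2 → ℤ) (g : ℤ), g ≠ 0 ∧ IsCoprime (e 0) (e 1) ∧ ∀ i, d i = g * e i := by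
  have hpos : 0 < Int.gcd (d 0) (d 1) := by
    rw [Int.gcd_pos_iff]
    by_contra! h
    exact hd (funext fun i => by fin_cases i <;> simp [h])
  obtain ⟨a, b, hab, ha, hb⟩ := Int.exists_gcd_one hpos
  refine ⟨![a, b], Int.gcd (d 0) (d 1), by exact_mod_cast hpos.ne',
    Int.isCoprime_iff_gcd_eq_one.2 hab, fun i => ?_⟩
  fin_cases i
  · simpa [mul_comm] using ha
  · simpa [mul_comm] using hb

/-- Along an ultrafilter which tends to infinity in the torus and for which two monomials are
dominant, the dominant monomials are those of a face in an outer direction `(-e 1, e 0)`. -/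
theorem exists_face_direction (U : Ultrafilter (Fin 2 → ℝ))
    (hne : ∀ᶠ p : Fin 2 → ℝ in U, ∀ i, p i ≠ 0) (hunb : ∀ R : ℝ, ∀ᶠ p : Fin 2 → ℝ in U, ∃ i, R < |p i|)
    {s : Finset (Fin 2 →₀ ℕ)} {m₀ m₁ : Fin 2 →₀ ℕ}
    (hmax : ∀ m ∈ s, ∀ᶠ p in U, |monomialValue p m| ≤ |monomialValue p m₀|) (h01 : m₁ ≠ m₀) {ρ : ℝ}
    (hρ0 : ρ ≠ 0) (hρ : Tendsto (fun p => monomialValue p m₁ / monomialValue p m₀) U (𝓝 ρ)) :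
    ∃ (e a : Fin 2 → ℤ) (τ : ℝ), a 0 * e 0 + a 1 * e 1 = 1 ∧ τ ≠ 0 ∧ (0 < -e 1 ∨ 0 < e 0) ∧
      ∀ m ∈ s, -e 1 * ((m 0 : ℤ) - m₀ 0) + e 0 * ((m 1 : ℤ) - m₀ 1) ≤ 0 ∧
        (-e 1 * ((m 0 : ℤ) - m₀ 0) + e 0 * ((m 1 : ℤ) - m₀ 1) = 0 →
          Tendsto (fun p => monomialValue p m / monomialValue p m₀) U
            (𝓝 (τ ^ (a 0 * ((m 0 : ℤ) - m₀ 0) + a 1 * ((m 1 : ℤ) - m₀ 1))))) ∧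
        (-e 1 * ((m 0 : ℤ) - m₀ 0) + e 0 * ((m 1 : ℤ) - m₀ 1) < 0 →
          Tendsto (fun p => monomialValue p m / monomialValue p m₀) U (𝓝 0)) := by
  obtain ⟨e, g, hg, ⟨a₀, a₁, hcop⟩, hd, hpos⟩ : ∃ (e : Fin 2 → ℤ) (g : ℤ), g ≠ 0 ∧
      IsCoprime (e 0) (e 1) ∧ (∀ i, (m₁ i : ℤ) - m₀ i = g * e i) ∧
      ∀ᶠ p : Fin 2 → ℝ in U, 0 ≤ -(e 1 : ℝ) * Real.log |p 0| + e 0 * Real.log |p 1| := by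
    obtain ⟨e, g, hg, hcop, hd⟩ := exists_primitive_multiple
      (d := fun i => (m₁ i : ℤ) - m₀ i) fun h => h01 <| Finsupp.ext fun i => by
        have := congr_fun h i
        simp only [Pi.zero_apply] at this
        omega
    rcases Ultrafilter.eventually_or.1 (Eventually.of_forall (f := (U : Filter (Fin 2 → ℝ)))
      fun p => le_total 0 (-(e 1 : ℝ) * Real.log |p 0| + e 0 * Real.log |p 1|)) with h | h
    · exact ⟨e, g, hg, hcop, hd, h⟩
    · refine ⟨-e, -g, neg_ne_zero.2 hg, hcop.neg_neg, fun i => by simp [hd i], h.mono fun p hp => ?_⟩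
      simp only [Pi.neg_apply, Int.cast_neg]
      linarith
  set u : (Fin 2 → ℝ) → ℝ := fun p => Real.log |p 0| with hu
  set v : (Fin 2 → ℝ) → ℝ := fun p => Real.log |p 1| with hv
  set E : (Fin 2 → ℝ) → ℝ := fun p => e 0 * u p + e 1 * v p with hE
  set A : (Fin 2 → ℝ) → ℝ := fun p => -e 1 * u p + e 0 * v p with hA
  have he : (1 : ℝ) ≤ (e 0 : ℝ) ^ 2 + (e 1 : ℝ) ^ 2 := by
    have h : 0 < e 0 ^ 2 + e 1 ^ 2 := by
      by_contra! h
      have h0 : e 0 = 0 := by nlinarith [sq_nonneg (e 0), sq_nonneg (e 1)]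
      have h1 : e 1 = 0 := by nlinarith [sq_nonneg (e 0), sq_nonneg (e 1)]
      simp [h0, h1] at hcop
    exact_mod_cast h
  have hunb' : ∀ R : ℝ, ¬ ∀ᶠ p in U, u p ≤ R ∧ v p ≤ R := by
    intro R hR
    obtain ⟨p, ⟨hp1, hp2⟩, i, hi⟩ := (hR.and (hunb (Real.exp R))).exists
    have hi' : R < Real.log |p i| := (Real.lt_log_iff_exp_lt ((Real.exp_pos R).trans hi)).2 hi
    fin_cases i
    · exact absurd hp1 (not_le.2 hi')
    · exact absurd hp2 (not_le.2 hi')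
  have hscale : ∀ x b : ℝ, 0 ≤ b → ((e 0 : ℝ) ^ 2 + (e 1 : ℝ) ^ 2) * x ≤ b → x ≤ b := by
    intro x b hb h
    rcases le_total x 0 with hx | hx
    · exact hx.trans hb
    · nlinarith
  have hNu : ∀ p, ((e 0 : ℝ) ^ 2 + (e 1 : ℝ) ^ 2) * u p = e 0 * E p - e 1 * A p := by
    intro p; simp only [hE, hA]; ring
  have hNv : ∀ p, ((e 0 : ℝ) ^ 2 + (e 1 : ℝ) ^ 2) * v p = e 1 * E p + e 0 * A p := by
    intro p; simp only [hE, hA]; ring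
  have hcoord : ∀ (δ : Fin 2 → ℝ) p, δ 0 * u p + δ 1 * v p =
      (δ 0 * e 0 + δ 1 * e 1) / ((e 0 : ℝ) ^ 2 + (e 1 : ℝ) ^ 2) * E p +
      (-e 1 * δ 0 + e 0 * δ 1) / ((e 0 : ℝ) ^ 2 + (e 1 : ℝ) ^ 2) * A p := by
    intro δ p
    have : (e 0 : ℝ) ^ 2 + (e 1 : ℝ) ^ 2 ≠ 0 := by linarith
    simp only [hE, hA]
    field_simp
    ring
  have hlog : ∀ᶠ p in U, ∀ m, Real.log |monomialValue p m / monomialValue p m₀| =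
      ((m 0 : ℝ) - m₀ 0) * u p + ((m 1 : ℝ) - m₀ 1) * v p := by
    filter_upwards [hne] with p hp m
    rw [abs_div, Real.log_div (abs_ne_zero.2 (monomialValue_ne_zero hp _))
      (abs_ne_zero.2 (monomialValue_ne_zero hp _)), log_abs_monomialValue hp,
      log_abs_monomialValue hp]
    ring
  have hEt : Tendsto E U (𝓝 (Real.log |ρ| / g)) := by
    refine (((hρ.abs).log (abs_ne_zero.2 hρ0)).div_const (g : ℝ)).congr' ?_
    filter_upwards [hlog] with p hp
    have hg' : (g : ℝ) ≠ 0 := by exact_mod_cast hg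
    have h0 : (m₁ 0 : ℝ) - m₀ 0 = g * e 0 := by exact_mod_cast hd 0
    have h1 : (m₁ 1 : ℝ) - m₀ 1 = g * e 1 := by exact_mod_cast hd 1
    rw [hp, h0, h1]
    simp only [hE]
    field_simp
  obtain ⟨C, hC⟩ : ∃ C, ∀ᶠ p in U, |E p| ≤ C :=
    ⟨_, (hEt.abs.eventually (eventually_le_nhds (lt_add_one _)))⟩
  have habs : ∀ (k : ℤ) (x b : ℝ), |x| ≤ b → -(|(k : ℝ)| * b) ≤ k * x ∧ k * x ≤ |(k : ℝ)| * b := by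
    intro k x b h
    rw [← abs_le, abs_mul]
    exact mul_le_mul_of_nonneg_left h (abs_nonneg _)
  have hAt : Tendsto A U atTop := by
    rw [tendsto_atTop]
    intro R
    by_contra hR
    rw [← Ultrafilter.eventually_not] at hR
    refine hunb' (|(e 0 : ℝ)| * C + |(e 1 : ℝ)| * C + |(e 1 : ℝ)| * R + |(e 0 : ℝ)| * R) ?_
    filter_upwards [hC, hR, hpos] with p h1 h2 h3
    have hA3 : |A p| ≤ R := by rw [abs_of_nonneg h3]; exact (not_le.1 h2).le
    have hC0 : 0 ≤ C := (abs_nonneg _).trans h1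
    have hR0 : 0 ≤ R := (abs_nonneg _).trans hA3
    have h00 := mul_nonneg (abs_nonneg (e 0 : ℝ)) hC0
    have h01 := mul_nonneg (abs_nonneg (e 0 : ℝ)) hR0
    have h10 := mul_nonneg (abs_nonneg (e 1 : ℝ)) hC0
    have h11 := mul_nonneg (abs_nonneg (e 1 : ℝ)) hR0
    have k1 := habs (e 0) _ _ h1
    have k2 := habs (e 1) _ _ h1
    have k3 := habs (e 0) _ _ hA3
    have k4 := habs (e 1) _ _ hA3
    constructor
    · refine hscale _ _ (by positivity) ?_
      rw [hNu]
      linarith [k1.2, k4.1]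
    · refine hscale _ _ (by positivity) ?_
      rw [hNv]
      linarith [k2.2, k3.2]
  have hξ : 0 < -e 1 ∨ 0 < e 0 := by
    by_contra! h
    have h0 : 0 ≤ (e 1 : ℝ) := by exact_mod_cast (by linarith [h.1] : 0 ≤ e 1)
    have h1 : (e 0 : ℝ) ≤ 0 := by exact_mod_cast h.2
    refine hunb' (|(e 0 : ℝ)| * C + |(e 1 : ℝ)| * C) ?_
    filter_upwards [hC, hpos] with p h2 h3
    have hC0 : 0 ≤ C := (abs_nonneg _).trans h2
    have h00 := mul_nonneg (abs_nonneg (e 0 : ℝ)) hC0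
    have h10 := mul_nonneg (abs_nonneg (e 1 : ℝ)) hC0
    have k1 := habs (e 0) _ _ h2
    have k2 := habs (e 1) _ _ h2
    have k3 : (e 0 : ℝ) * A p ≤ 0 := mul_nonpos_of_nonpos_of_nonneg h1 h3
    have k4 : 0 ≤ (e 1 : ℝ) * A p := mul_nonneg h0 h3
    constructor
    · refine hscale _ _ (by positivity) ?_
      rw [hNu]
      linarith [k1.2]
    · refine hscale _ _ (by positivity) ?_
      rw [hNv]
      linarith [k2.2]
  have hexpE : ∀ᶠ p : Fin 2 → ℝ in U, |p 0 ^ e 0 * p 1 ^ e 1| = Real.exp (E p) := by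
    filter_upwards [hne] with p hp
    have hp0 := abs_pos.2 (hp 0)
    have hp1 := abs_pos.2 (hp 1)
    rw [abs_mul, abs_zpow, abs_zpow, ← Real.exp_log (zpow_pos hp0 (e 0)),
      ← Real.exp_log (zpow_pos hp1 (e 1)), ← Real.exp_add, Real.log_zpow, Real.log_zpow]
  obtain ⟨τ, hτ⟩ : ∃ τ, Tendsto (fun p : Fin 2 → ℝ => p 0 ^ e 0 * p 1 ^ e 1) U (𝓝 τ) := by
    refine U.exists_tendsto_of_abs_le (C := Real.exp C) ?_
    filter_upwards [hC, hexpE] with p h1 h2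
    rw [h2]
    exact Real.exp_le_exp.2 ((le_abs_self _).trans h1)
  have hτ0 : τ ≠ 0 := by
    have h1 := tendsto_nhds_unique (hτ.abs.congr' hexpE) hEt.rexp
    exact abs_ne_zero.1 (h1 ▸ (Real.exp_pos _).ne')
  have hN : (0 : ℝ) < (e 0 : ℝ) ^ 2 + (e 1 : ℝ) ^ 2 := by linarith
  have hcomb : ∀ (δ : Fin 2 → ℝ), Tendsto (fun p => (δ 0 * e 0 + δ 1 * e 1) /
      ((e 0 : ℝ) ^ 2 + (e 1 : ℝ) ^ 2) * E p) U (𝓝 _) := fun δ => hEt.const_mul _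
  refine ⟨e, ![a₀, a₁], τ, hcop, hτ0, hξ, fun m hm => ?_⟩
  set δ : Fin 2 → ℝ := fun i => (m i : ℝ) - m₀ i with hδ
  have hcast : ((-e 1 * ((m 0 : ℤ) - m₀ 0) + e 0 * ((m 1 : ℤ) - m₀ 1) : ℤ) : ℝ) =
      -e 1 * δ 0 + e 0 * δ 1 := by simp [hδ]
  refine ⟨?_, fun h => ?_, fun h => ?_⟩
  · by_contra! h
    have h' : 0 < -e 1 * δ 0 + e 0 * δ 1 := by rw [← hcast]; exact_mod_cast h
    have ht := (hcomb δ).add_atTop (hAt.const_mul_atTop (div_pos h' hN))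
    obtain ⟨p, hp, h1, h2, h3⟩ :=
      ((ht.eventually_gt_atTop 0).and ((hmax m hm).and (hlog.and hne))).exists
    have h4 := h2 m
    have h5 : Real.log |monomialValue p m / monomialValue p m₀| ≤ 0 := by
      refine Real.log_nonpos (abs_nonneg _) ?_
      rw [abs_div]
      exact div_le_one_of_le₀ h1 (abs_nonneg _)
    have h6 := hcoord δ p
    simp only [hδ] at h6 hp
    linarith
  · refine (hτ.zpow₀ _ (Or.inl hτ0)).congr' ?_
    filter_upwards [hne] with p hp
    refine (monomialValue_div_eq_zpow hp fun i => ?_).symm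
    fin_cases i
    · simp
      linear_combination -a₁ * h - ((m 0 : ℤ) - m₀ 0) * hcop
    · simp
      linear_combination a₀ * h - ((m 1 : ℤ) - m₀ 1) * hcop
  · have h' : -e 1 * δ 0 + e 0 * δ 1 < 0 := by rw [← hcast]; exact_mod_cast h
    have ht := (hcomb δ).add_atBot (hAt.const_mul_atTop_of_neg (div_neg_of_neg_of_pos h' hN))
    refine tendsto_zero_iff_abs_tendsto_zero _ |>.2 ((Real.tendsto_exp_atBot.comp ht).congr' ?_)
    filter_upwards [hne, hlog] with p hp h1
    have h2 : 0 < |monomialValue p m / monomialValue p m₀| :=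
      abs_pos.2 (div_ne_zero (monomialValue_ne_zero hp _) (monomialValue_ne_zero hp _))
    simp only [Function.comp_apply]
    rw [← hcoord δ p, ← Real.exp_log h2, h1]

theorem mul_eval_pderiv_eq_sum (f : MvPolynomial (Fin 2) ℝ) (p : Fin 2 → ℝ) (i : Fin 2) :
    p i * eval p (pderiv i f) = ∑ m ∈ f.support, f.coeff m * m i * monomialValue p m := by
  have h : X i * pderiv i f = ∑ m ∈ f.support, m i • monomial m (f.coeff m) := by
    conv_lhs => rw [f.as_sum]
    simp only [map_sum, Finset.mul_sum, X_mul_pderiv_monomial]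
  have h' := congr_arg (eval p) h
  rw [map_mul, eval_X] at h'
  rw [h', map_sum]
  refine Finset.sum_congr rfl fun m _ => ?_
  rw [map_nsmul, eval_monomial, Finsupp.prod_fintype _ _ (by simp), Fin.prod_univ_two,
    monomialValue, nsmul_eq_mul]
  ring

/-- The dominant part of a logarithmic derivative vanishes along an ultrafilter at infinity if the
corresponding partial derivative tends to zero. -/
theorem sum_coeff_mul_limit_eq_zero (f : MvPolynomial (Fin 2) ℝ) (U : Ultrafilter (Fin 2 → ℝ))
    (hne : ∀ᶠ p : Fin 2 → ℝ in U, ∀ i, p i ≠ 0)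
    (hunb : ∀ R : ℝ, ∀ᶠ p : Fin 2 → ℝ in U, ∃ i, R < |p i|)
    {m₀ : Fin 2 →₀ ℕ}
    (hpow : ∀ i, ∃ n : ℕ, 0 < n ∧ ∀ᶠ p : Fin 2 → ℝ in U, |p i| ^ n ≤ |monomialValue p m₀|)
    {ρ : (Fin 2 →₀ ℕ) → ℝ} (hρ : ∀ m ∈ f.support,
      Tendsto (fun p => monomialValue p m / monomialValue p m₀) U (𝓝 (ρ m)))
    {i : Fin 2} (hi : Tendsto (fun p => eval p (pderiv i f)) U (𝓝 0)) :
    ∑ m ∈ f.support, f.coeff m * m i * ρ m = 0 := by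
  have h1 : Tendsto (fun p => eval p (pderiv i f) * (p i / monomialValue p m₀)) U
      (𝓝 (∑ m ∈ f.support, f.coeff m * m i * ρ m)) := by
    refine (tendsto_finsetSum _ fun m hm => (hρ m hm).const_mul (f.coeff m * m i)).congr fun p => ?_
    rw [← mul_div_assoc, mul_comm _ (p i), mul_eval_pderiv_eq_sum, Finset.sum_div]
    exact Finset.sum_congr rfl fun m _ => by ring
  refine tendsto_nhds_unique h1 (hi.zero_mul_isBoundedUnder_le ?_)
  refine isBoundedUnder_of_eventually_le (a := 1) ?_
  have hall : ∀ᶠ p : Fin 2 → ℝ in U, ∀ i, ∃ n : ℕ, 0 < n ∧ |p i| ^ n ≤ |monomialValue p m₀| := by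
    refine eventually_all.2 fun i => ?_
    obtain ⟨n, hn, h⟩ := hpow i
    exact h.mono fun p hp => ⟨n, hn, hp⟩
  filter_upwards [hne, hunb 1, hall] with p h2 ⟨k, h3⟩ h4
  rw [Function.comp_apply, norm_div, Real.norm_eq_abs, Real.norm_eq_abs]
  refine div_le_one_of_le₀ ?_ (abs_nonneg _)
  rcases le_total |p i| 1 with h | h
  · obtain ⟨n, -, hn⟩ := h4 k
    exact (h.trans (one_le_pow₀ h3.le)).trans hn
  · obtain ⟨n, hn0, hn⟩ := h4 i
    exact (le_self_pow₀ h hn0.ne').trans hn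

theorem face_eq_sum_filter {f : MvPolynomial (Fin 2) ℝ} {e : Fin 2 → ℤ} {m₀ : Fin 2 →₀ ℕ}
    (hm₀ : m₀ ∈ f.support)
    (hle : ∀ m ∈ f.support, -e 1 * ((m 0 : ℤ) - m₀ 0) + e 0 * ((m 1 : ℤ) - m₀ 1) ≤ 0) :
    face (-(e 1 : ℝ), (e 0 : ℝ)) f = ∑ m ∈ f.support.filter (fun m =>
      -e 1 * ((m 0 : ℤ) - m₀ 0) + e 0 * ((m 1 : ℤ) - m₀ 1) = 0), monomial m (f.coeff m) := by
  classical
  rw [face]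
  refine Finset.sum_congr (Finset.filter_congr fun m hm => ?_) fun _ _ => rfl
  have hcast : ∀ m m' : Fin 2 →₀ ℕ, (-(e 1 : ℝ) * (m' 0 : ℝ) + (e 0 : ℝ) * (m' 1 : ℝ) ≤
      -(e 1 : ℝ) * (m 0 : ℝ) + (e 0 : ℝ) * (m 1 : ℝ)) ↔
      -e 1 * (m' 0 : ℤ) + e 0 * (m' 1 : ℤ) ≤ -e 1 * (m 0 : ℤ) + e 0 * (m 1 : ℤ) := by
    intro m m'
    exact_mod_cast Iff.rfl
  simp only [hcast]
  constructor
  · intro h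
    linarith [h m₀ hm₀, hle m hm]
  · intro h m' hm'
    linarith [hle m' hm']

theorem not_tendsto_gradient_zero_of_torus (f : MvPolynomial (Fin 2) ℝ)
    (hconv : ∀ i, ∃ n : ℕ, 0 < n ∧ f.coeff (Finsupp.single i n) ≠ 0)
    (hnd : ∀ ξ : ℝ × ℝ, (0 < ξ.1 ∨ 0 < ξ.2) →
      ∀ k : MvPolynomial (Fin 2) ℝ, ¬ IsUnit k → ¬ (X 0 ∣ k) → ¬ (X 1 ∣ k) →
        ¬ (k ^ 2 ∣ face ξ f))
    (U : Ultrafilter (Fin 2 → ℝ)) (hne : ∀ᶠ p : Fin 2 → ℝ in U, ∀ i, p i ≠ 0)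
    (hunb : ∀ R : ℝ, ∀ᶠ p : Fin 2 → ℝ in U, ∃ i, R < |p i|) :
    ¬ ∀ i, Tendsto (fun p => eval p (pderiv i f)) U (𝓝 0) := by
  intro hgrad
  have hsingle : ∀ i, ∃ n : ℕ, 0 < n ∧ Finsupp.single i n ∈ f.support := fun i =>
    let ⟨n, hn, h⟩ := hconv i
    ⟨n, hn, mem_support_iff.2 h⟩
  obtain ⟨m₀, hm₀, hmax⟩ : ∃ m₀ ∈ f.support, ∀ᶠ p in U, ∀ m ∈ f.support,
      |monomialValue p m| ≤ |monomialValue p m₀| := by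
    refine (Ultrafilter.eventually_exists_mem_iff (is := (f.support : Set (Fin 2 →₀ ℕ)))
      f.support.finite_toSet).1 (Eventually.of_forall fun p => ?_)
    obtain ⟨n, -, hn⟩ := hsingle 0
    exact f.support.exists_max_image (fun m => |monomialValue p m|) ⟨_, hn⟩
  have hlim : ∀ m, ∃ ρ, m ∈ f.support →
      Tendsto (fun p => monomialValue p m / monomialValue p m₀) U (𝓝 ρ) := by
    intro m
    by_cases hm : m ∈ f.support
    · obtain ⟨ρ, hρ⟩ := U.exists_tendsto_of_abs_le (C := 1) (hmax.mono fun p hp => by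
        rw [abs_div]
        exact div_le_one_of_le₀ (hp m hm) (abs_nonneg _))
      exact ⟨ρ, fun _ => hρ⟩
    · exact ⟨0, fun h => absurd h hm⟩
  choose ρ hρ using hlim
  have hpow : ∀ i, ∃ n : ℕ, 0 < n ∧ ∀ᶠ p : Fin 2 → ℝ in U, |p i| ^ n ≤ |monomialValue p m₀| := by
    intro i
    obtain ⟨n, hn, h⟩ := hsingle i
    refine ⟨n, hn, hmax.mono fun p hp => ?_⟩
    have := hp _ h
    fin_cases i <;> simpa [monomialValue] using this
  have hzero : ∀ i, ∑ m ∈ f.support, f.coeff m * m i * ρ m = 0 := fun i =>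
    sum_coeff_mul_limit_eq_zero f U hne hunb hpow hρ (hgrad i)
  by_cases hex : ∃ m₁ ∈ f.support, m₁ ≠ m₀ ∧ ρ m₁ ≠ 0
  · obtain ⟨m₁, hm₁, h01, hρ1⟩ := hex
    obtain ⟨e, a, τ, hae, hτ, hξ, hface⟩ := exists_face_direction U hne hunb
      (fun m hm => hmax.mono fun p hp => hp m hm) h01 hρ1 (hρ m₁ hm₁)
    set F := f.support.filter (fun m =>
      -e 1 * ((m 0 : ℤ) - m₀ 0) + e 0 * ((m 1 : ℤ) - m₀ 1) = 0) with hF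
    set k : (Fin 2 →₀ ℕ) → ℤ := fun m =>
      a 0 * ((m 0 : ℤ) - m₀ 0) + a 1 * ((m 1 : ℤ) - m₀ 1) with hk
    have hm₀F : m₀ ∈ F := by simp [hF, mem_support_iff.1 hm₀]
    obtain ⟨b, hb, hbmin⟩ := F.exists_min_image k ⟨m₀, hm₀F⟩
    obtain ⟨t, ht, htmax⟩ := F.exists_max_image k ⟨m₀, hm₀F⟩
    have hline : ∀ m ∈ F, ∀ i, (m i : ℤ) = b i + ((k m - k b).toNat : ℤ) * e i := by
      intro m hm i
      rw [Int.toNat_of_nonneg (sub_nonneg.2 (hbmin m hm))]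
      have h1 := (Finset.mem_filter.1 hm).2
      have h2 := (Finset.mem_filter.1 hb).2
      simp only [hk]
      fin_cases i
      · simp
        linear_combination a 1 * (h2 - h1) - ((m 0 : ℤ) - b 0) * hae
      · simp
        linear_combination a 0 * (h1 - h2) - ((m 1 : ℤ) - b 1) * hae
    have hsum : ∀ i, ∑ m ∈ F, f.coeff m * m i * τ ^ (k m - k b).toNat = 0 := by
      intro i
      have h1 : ∑ m ∈ F, f.coeff m * m i * ρ m = 0 := by
        rw [← hzero i, hF, Finset.sum_filter_of_ne]
        intro m hm h
        by_contra hlt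
        refine h ?_
        rw [tendsto_nhds_unique (hρ m hm)
          ((hface m hm).2.2 (lt_of_le_of_ne (hface m hm).1 hlt)), mul_zero]
      refine (mul_eq_zero.1 ?_).resolve_left (zpow_ne_zero (k b) hτ)
      rw [← h1, Finset.mul_sum]
      refine Finset.sum_congr rfl fun m hm => ?_
      have hm' := Finset.mem_filter.1 hm
      rw [tendsto_nhds_unique (hρ m hm'.1) ((hface m hm'.1).2.1 hm'.2)]
      have : τ ^ k m = τ ^ k b * τ ^ (k m - k b).toNat := by
        rw [← zpow_natCast, ← zpow_add₀ hτ, Int.toNat_of_nonneg (sub_nonneg.2 (hbmin m hm))]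
        congr 1; ring
      rw [← show k m = a 0 * ((m 0 : ℤ) - m₀ 0) + a 1 * ((m 1 : ℤ) - m₀ 1) from rfl, this]
      ring
    set G₀ := ∑ m ∈ F, f.coeff m * τ ^ (k m - k b).toNat with hG₀
    set G₁ := ∑ m ∈ F, f.coeff m * ((k m - k b).toNat : ℕ) * τ ^ (k m - k b).toNat with hG₁
    have hsys : ∀ i, (b i : ℝ) * G₀ + e i * G₁ = 0 := by
      intro i
      rw [← hsum i, hG₀, hG₁, Finset.mul_sum, Finset.mul_sum, ← Finset.sum_add_distrib]
      refine Finset.sum_congr rfl fun m hm => ?_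
      have h : (m i : ℝ) = b i + ((k m - k b).toNat : ℝ) * e i := by exact_mod_cast hline m hm i
      rw [h]; ring
    have hdet : 0 < -e 1 * (b 0 : ℤ) + e 0 * (b 1 : ℤ) := by
      have h2 := (Finset.mem_filter.1 hb).2
      rcases hξ with h | h
      · obtain ⟨n, hn, hns⟩ := hsingle 0
        have h3 := (hface _ hns).1
        simp at h3
        have : 0 < -e 1 * (n : ℤ) := mul_pos h (by exact_mod_cast hn)
        linarith
      · obtain ⟨n, hn, hns⟩ := hsingle 1
        have h3 := (hface _ hns).1
        simp at h3
        have : 0 < e 0 * (n : ℤ) := mul_pos h (by exact_mod_cast hn)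
        linarith
    have hdet' : (-e 1 * (b 0 : ℝ) + e 0 * (b 1 : ℝ)) ≠ 0 := by exact_mod_cast hdet.ne'
    have hG₀0 : G₀ = 0 := (mul_eq_zero.1 (by
      linear_combination -(e 1 : ℝ) * hsys 0 + e 0 * hsys 1 :
        (-e 1 * (b 0 : ℝ) + e 0 * (b 1 : ℝ)) * G₀ = 0)).resolve_left hdet'
    have hG₁0 : G₁ = 0 := (mul_eq_zero.1 (by
      linear_combination (b 1 : ℝ) * hsys 0 - b 0 * hsys 1 :
        (-e 1 * (b 0 : ℝ) + e 0 * (b 1 : ℝ)) * G₁ = 0)).resolve_left hdet'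
    have he : e ≠ 0 := by
      rintro rfl
      simp at hae
    obtain ⟨q, hq1, hq2, hq3, hq4⟩ := exists_sq_dvd_of_double_root (F := F) (c := f.coeff)
      (j := fun m => (k m - k b).toNat) (N := (k t - k b).toNat) (B := fun i => b i) he
      (fun i => by positivity) (fun i => by rw [← hline t ht i]; positivity)
      (fun m hm => Int.toNat_le_toNat (by linarith [htmax m hm])) hline hτ hG₀0 hG₁0
    have hξ' : (0 : ℝ) < -(e 1 : ℝ) ∨ (0 : ℝ) < (e 0 : ℝ) := by exact_mod_cast hξ
    refine hnd (-(e 1 : ℝ), (e 0 : ℝ)) hξ' q hq1 hq2 hq3 ?_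
    rw [face_eq_sum_filter hm₀ fun m hm => (hface m hm).1]
    exact hq4
  · push Not at hex
    have hρ₀ : ρ m₀ = 1 := by
      refine tendsto_nhds_unique (hρ m₀ hm₀) (tendsto_const_nhds.congr' ?_)
      filter_upwards [hne] with p hp
      rw [div_self (monomialValue_ne_zero hp _)]
    have hm₀0 : ∀ i, m₀ i = 0 := by
      intro i
      have h := hzero i
      rw [Finset.sum_eq_single_of_mem m₀ hm₀ fun m hm hmm => by rw [hex m hm hmm, mul_zero], hρ₀,
        mul_one, mul_eq_zero] at h
      exact_mod_cast h.resolve_left (mem_support_iff.1 hm₀)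
    choose n hn hpn using hpow
    obtain ⟨p, ⟨i, hi⟩, hp⟩ := ((hunb 1).and (eventually_all.2 hpn)).exists
    have h := hp i
    simp only [monomialValue, hm₀0, pow_zero, mul_one, abs_one] at h
    exact absurd h (not_le.2 (one_lt_pow₀ hi (hn i).ne'))

theorem coeff_aeval_single (g : MvPolynomial (Fin 2) ℝ) (j : Fin 2) (n : ℕ) :
    (aeval (Pi.single j Polynomial.X : Fin 2 → Polynomial ℝ) g).coeff n =
      g.coeff (Finsupp.single j n) := by
  classical
  induction g using MvPolynomial.induction_on' with
  | add p q hp hq => simp [hp, hq]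
  | monomial m c =>
    rw [aeval_monomial, Finsupp.prod_fintype _ _ (by simp), Fin.prod_univ_two, coeff_monomial,
      Polynomial.algebraMap_eq, Polynomial.coeff_C_mul]
    have hiff : m = Finsupp.single j n ↔ m 0 = (Finsupp.single j n : Fin 2 →₀ ℕ) 0 ∧
        m 1 = (Finsupp.single j n : Fin 2 →₀ ℕ) 1 := by
      rw [Finsupp.ext_iff, Fin.forall_fin_two]
    simp only [hiff]
    fin_cases j
    · rcases Nat.eq_zero_or_pos (m 1) with h | h
      · simp [h, Polynomial.coeff_X_pow, eq_comm]
      · simp [h.ne']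
    · rcases Nat.eq_zero_or_pos (m 0) with h | h
      · simp [h, Polynomial.coeff_X_pow, eq_comm]
      · simp [h.ne']

theorem eval_eq_eval_aeval_single (g : MvPolynomial (Fin 2) ℝ) {j : Fin 2} {p : Fin 2 → ℝ}
    (hp : ∀ k ≠ j, p k = 0) :
    eval p g = (aeval (Pi.single j Polynomial.X : Fin 2 → Polynomial ℝ) g).eval (p j) := by
  induction g using MvPolynomial.induction_on with
  | C a => simp
  | add p q h₁ h₂ => simp [h₁, h₂]
  | mul_X g k h =>
    rw [map_mul, map_mul, Polynomial.eval_mul, h, eval_X, aeval_X]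
    by_cases hk : k = j
    · subst hk
      simp
    · simp [hk, hp k hk]

theorem not_tendsto_pderiv_zero_of_axis (f : MvPolynomial (Fin 2) ℝ) {i j : Fin 2} (hij : i ≠ j)
    (hconv : ∃ n : ℕ, 0 < n ∧ f.coeff (Finsupp.single j n) ≠ 0) (U : Ultrafilter (Fin 2 → ℝ))
    (hi : ∀ᶠ p : Fin 2 → ℝ in U, p i = 0)
    (hunb : ∀ R : ℝ, ∀ᶠ p : Fin 2 → ℝ in U, ∃ i, R < |p i|) :
    ¬ Tendsto (fun p => eval p (pderiv j f)) U (𝓝 0) := by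
  intro hlim
  obtain ⟨n, hn, hc⟩ := hconv
  set q : Polynomial ℝ := aeval (Pi.single j Polynomial.X : Fin 2 → Polynomial ℝ) (pderiv j f)
    with hq
  have hq0 : q ≠ 0 := by
    intro h
    have h1 : q.coeff (n - 1) = 0 := by rw [h, Polynomial.coeff_zero]
    rw [hq, coeff_aeval_single, coeff_pderiv, ← Finsupp.single_add, Nat.sub_add_cancel hn,
      mul_eq_zero] at h1
    rcases h1 with h1 | h1
    · exact hc h1
    · exact Nat.cast_add_one_ne_zero _ h1
  have heval : ∀ᶠ p in U, eval p (pderiv j f) = q.eval (p j) := by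
    filter_upwards [hi] with p hp
    exact eval_eq_eval_aeval_single _ fun k hk => by rwa [show k = i by omega]
  have hj : Tendsto (fun p : Fin 2 → ℝ => ‖p j‖) U atTop := by
    rw [tendsto_atTop]
    intro R
    filter_upwards [hi, hunb (max R 0)] with p hp ⟨k, hk⟩
    have hki : k ≠ i := by
      rintro rfl
      rw [hp, abs_zero] at hk
      exact absurd hk (not_lt.2 (le_max_right _ _))
    obtain rfl : k = j := by omega
    exact (le_max_left _ _).trans hk.le
  have hlim' := hlim.congr' heval
  rcases lt_or_ge 0 q.degree with h | h
  · exact not_tendsto_nhds_of_tendsto_atTop (q.tendsto_norm_atTop h hj) _ hlim'.norm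
  · rw [Polynomial.eq_C_of_degree_le_zero h] at hlim' hq0
    simp only [Polynomial.eval_C] at hlim'
    exact hq0 (by rw [tendsto_nhds_unique tendsto_const_nhds hlim', Polynomial.C_0])

theorem exists_gradient_lower_bound (f : MvPolynomial (Fin 2) ℝ)
    (hconv : ∀ i, ∃ n : ℕ, 0 < n ∧ f.coeff (Finsupp.single i n) ≠ 0)
    (hcrit : ∀ p : Fin 2 → ℝ, eval p (pderiv 0 f) ≠ 0 ∨ eval p (pderiv 1 f) ≠ 0)
    (hnd : ∀ ξ : ℝ × ℝ, (0 < ξ.1 ∨ 0 < ξ.2) →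
      ∀ k : MvPolynomial (Fin 2) ℝ, ¬ IsUnit k → ¬ (X 0 ∣ k) → ¬ (X 1 ∣ k) →
        ¬ (k ^ 2 ∣ face ξ f)) :
    ∃ c > 0, ∀ p, c ≤ eval p (pderiv 0 f) ^ 2 + eval p (pderiv 1 f) ^ 2 := by
  by_contra! hcon
  set D : (Fin 2 → ℝ) → ℝ := fun p => eval p (pderiv 0 f) ^ 2 + eval p (pderiv 1 f) ^ 2 with hD
  have hne : (comap D (𝓝 0)).NeBot := by
    rw [comap_neBot_iff]
    intro t ht
    obtain ⟨ε, hε, h⟩ := Metric.mem_nhds_iff.1 ht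
    obtain ⟨p, hp⟩ := hcon ε hε
    refine ⟨p, h ?_⟩
    rw [mem_ball_zero_iff, Real.norm_of_nonneg (by positivity)]
    exact hp
  set U := Ultrafilter.of (comap D (𝓝 0))
  have hDU : Tendsto D U (𝓝 0) := tendsto_iff_comap.2 (Ultrafilter.of_le _)
  have hgrad : ∀ i, Tendsto (fun p => eval p (pderiv i f)) U (𝓝 0) := by
    intro i
    refine (tendsto_zero_iff_abs_tendsto_zero _).2 ?_
    refine squeeze_zero (fun p => abs_nonneg _) (fun p => ?_)
      (by simpa using hDU.sqrt : Tendsto (fun p => √(D p)) U (𝓝 0))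
    rw [Function.comp_apply, ← Real.sqrt_sq_eq_abs]
    apply Real.sqrt_le_sqrt
    fin_cases i <;> simp [hD, sq_nonneg]
  have hunb : ∀ R : ℝ, ∀ᶠ p : Fin 2 → ℝ in U, ∃ i, R < |p i| := by
    intro R
    by_contra h
    rw [← Ultrafilter.eventually_not] at h
    obtain ⟨p, -, hp⟩ := (isCompact_univ_pi fun _ : Fin 2 => isCompact_Icc (a := -R)
      (b := R)).ultrafilter_le_nhds U (le_principal_iff.2 (h.mono fun p hp i _ => by
        push Not at hp
        exact abs_le.1 (hp i)))
    have hzero : ∀ i, eval p (pderiv i f) = 0 := fun i =>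
      tendsto_nhds_unique (((pderiv i f).continuous_eval.tendsto p).mono_left hp) (hgrad i)
    rcases hcrit p with h | h
    · exact h (hzero 0)
    · exact h (hzero 1)
  rcases U.em fun p => ∀ i, p i ≠ 0 with h | h
  · exact not_tendsto_gradient_zero_of_torus f hconv hnd U h hunb hgrad
  · have h' : ∀ᶠ p : Fin 2 → ℝ in U, ∃ i, p i = 0 := h.mono fun p hp => by
      push Not at hp
      exact hp
    obtain ⟨i, hi⟩ := Ultrafilter.eventually_exists_iff.1 h'
    obtain ⟨j, hij⟩ := exists_ne i
    exact not_tendsto_pderiv_zero_of_axis f hij.symm (hconv j) U hi hunb (hgrad j)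

theorem level_sets_connected_of_nondegenerate (f : MvPolynomial (Fin 2) ℝ)
    -- `f` is convenient: positive powers of `x` and of `y` occur in `f`
    (hconvx : ∃ n : ℕ, 0 < n ∧ f.coeff (Finsupp.single 0 n) ≠ 0)
    (hconvy : ∃ n : ℕ, 0 < n ∧ f.coeff (Finsupp.single 1 n) ≠ 0)
    -- `f` has no critical points
    (hcrit : ∀ p : Fin 2 → ℝ,
      eval p (pderiv 0 f) ≠ 0 ∨ eval p (pderiv 1 f) ≠ 0)
    -- `f` is non-degenerated on every outer face of its Newton polygon:
    -- no square of a polynomial not divisible by `x` nor `y` divides the restriction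
    (hnd : ∀ ξ : ℝ × ℝ, (0 < ξ.1 ∨ 0 < ξ.2) →
      ∀ k : MvPolynomial (Fin 2) ℝ, ¬ IsUnit k → ¬ (X 0 ∣ k) → ¬ (X 1 ∣ k) →
        ¬ (k ^ 2 ∣ face ξ f)) :
    ∀ t : ℝ, IsPreconnected {p : Fin 2 → ℝ | eval p f = t} := by
  intro t
  obtain ⟨c, hc, h⟩ := exists_gradient_lower_bound f
    (Fin.forall_fin_two.2 ⟨hconvx, hconvy⟩) hcrit hnd
  exact isPreconnected_level_of_gradient_bounded_below f hc h t
end
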